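/- Let R be a definable ring. Every nonzero element a ∈ R is either a unit (R has a multiplicative identity 1 and there exists b with a·b = b·a = 1) or a zero-divisor (there exists c ≠ 0 with a·c = 0 or c·a = 0). In particular, if R is not unital, then every nonzero element of R is a zero-divisor. -/

import Mathlib

open FirstOrder

namespace OMin

variable (L : FirstOrder.Language) (M : Type) [L.Structure M]

/-- A set of tuples from `M` is *definable* (with arbitrary parameters from `M`). -/
def Defin {α : Type} (s : Set (α → M)) : Prop :=
  Set.Definable (Set.univ : Set M) L s

section Order

variable [LinearOrder M]

/-- A subset of `M` that is a single point or an open interval. -/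
def IsPointOrInterval (s : Set M) : Prop :=
  (∃ a, s = {a}) ∨ (∃ a b, s = Set.Ioo a b) ∨ (∃ a, s = Set.Ioi a) ∨
    (∃ a, s = Set.Iio a) ∨ s = Set.univ

/-- `M` (with the structure of `L` and the order `<`) is an o-minimal structure:
a structure on a dense linear order without endpoints, whose order is definable,
such that every definable subset of `M` is a finite union of points and open intervals. -/
def OMinimal : Prop :=
  DenselyOrdered M ∧ NoMinOrder M ∧ NoMaxOrder M ∧ Nonempty M ∧
    Defin L M {x : Fin 2 → M | x 0 < x 1} ∧
    ∀ s : Set M, Defin L M {x : Fin 1 → M | x 0 ∈ s} →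
      ∃ (n : ℕ) (t : Fin n → Set M), (∀ i, IsPointOrInterval M (t i)) ∧ s = ⋃ i, t i

/-- The order topology on `M`. -/
def otop : TopologicalSpace M := Preorder.topology M

/-- The product of the order topology on tuples. -/
def ptop (k : ℕ) : TopologicalSpace (Fin k → M) :=
  @Pi.topologicalSpace (Fin k) (fun _ => M) (fun _ => otop M)

/-- A definable set `S` is definably connected iff it is not the union of two disjoint
nonempty definable subsets that are open in `S`. -/
def DefConnected {k : ℕ} (S : Set (Fin k → M)) : Prop :=
  ∀ U V : Set (Fin k → M), Defin L M U → Defin L M V →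
    (∃ U', @IsOpen _ (ptop M k) U' ∧ U = U' ∩ S) →
    (∃ V', @IsOpen _ (ptop M k) V' ∧ V = V' ∩ S) →
    U ∪ V = S → U ∩ V = ∅ → (U = ∅ ∨ V = ∅)

/-- `X ⊆ M^k` has dimension at least `n`: some coordinate projection to `M^n` of `X`
has nonempty interior. -/
def DimGE {k : ℕ} (X : Set (Fin k → M)) (n : ℕ) : Prop :=
  ∃ f : Fin n → Fin k, Function.Injective f ∧
    (@interior _ (ptop M n) ((fun x : Fin k → M => x ∘ f) '' X)).Nonempty

/-- `X` has dimension exactly `n`: `n` is the largest integer such that the image of `X`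
under some coordinate projection `M^k → M^n` has nonempty interior. -/
def DimEq {k : ℕ} (X : Set (Fin k → M)) (n : ℕ) : Prop :=
  DimGE M X n ∧ ∀ m : ℕ, DimGE M X m → m ≤ n

end Order

/-- A definable abelian group: a definable set with definable group operations. -/
structure DefAbGroup where
  k : ℕ
  carrier : Set (Fin k → M)
  zero : Fin k → M
  add : (Fin k → M) → (Fin k → M) → (Fin k → M)
  neg : (Fin k → M) → (Fin k → M)
  zero_mem : zero ∈ carrier
  add_mem : ∀ x ∈ carrier, ∀ y ∈ carrier, add x y ∈ carrier
  neg_mem : ∀ x ∈ carrier, neg x ∈ carrier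
  hadd_assoc : ∀ x ∈ carrier, ∀ y ∈ carrier, ∀ z ∈ carrier,
    add (add x y) z = add x (add y z)
  hadd_comm : ∀ x ∈ carrier, ∀ y ∈ carrier, add x y = add y x
  hzero_add : ∀ x ∈ carrier, add zero x = x
  hneg_add : ∀ x ∈ carrier, add (neg x) x = zero
  carrier_def : Defin L M carrier
  add_def : Defin L M {p : (Fin k ⊕ Fin k ⊕ Fin k) → M |
    (fun i => p (Sum.inl i)) ∈ carrier ∧ (fun i => p (Sum.inr (Sum.inl i))) ∈ carrier ∧
    add (fun i => p (Sum.inl i)) (fun i => p (Sum.inr (Sum.inl i))) =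
      fun i => p (Sum.inr (Sum.inr i))}
  neg_def : Defin L M {p : (Fin k ⊕ Fin k) → M |
    (fun i => p (Sum.inl i)) ∈ carrier ∧
    neg (fun i => p (Sum.inl i)) = fun i => p (Sum.inr i)}

/-- A definable (not necessarily unital or commutative) ring: a definable abelian group
together with a definable associative multiplication distributing over the addition. -/
structure DefRing extends DefAbGroup L M where
  mul : (Fin k → M) → (Fin k → M) → (Fin k → M)
  mul_mem : ∀ x ∈ carrier, ∀ y ∈ carrier, mul x y ∈ carrier
  hmul_assoc : ∀ x ∈ carrier, ∀ y ∈ carrier, ∀ z ∈ carrier,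
    mul (mul x y) z = mul x (mul y z)
  hleft_distrib : ∀ x ∈ carrier, ∀ y ∈ carrier, ∀ z ∈ carrier,
    mul x (add y z) = add (mul x y) (mul x z)
  hright_distrib : ∀ x ∈ carrier, ∀ y ∈ carrier, ∀ z ∈ carrier,
    mul (add x y) z = add (mul x z) (mul y z)
  mul_def : Defin L M {p : (Fin k ⊕ Fin k ⊕ Fin k) → M |
    (fun i => p (Sum.inl i)) ∈ carrier ∧ (fun i => p (Sum.inr (Sum.inl i))) ∈ carrier ∧
    mul (fun i => p (Sum.inl i)) (fun i => p (Sum.inr (Sum.inl i))) =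
      fun i => p (Sum.inr (Sum.inr i))}

end OMin
namespace OMin

namespace DefAbGroup

variable {L : FirstOrder.Language} {M : Type} [L.Structure M] (G : DefAbGroup L M)

/-- `n • x` in the group `G`. -/
def nsmul : ℕ → (Fin G.k → M) → (Fin G.k → M)
  | 0, _ => G.zero
  | n + 1, x => G.add x (nsmul n x)

/-- Sum of a list of elements. -/
def listSum : List (Fin G.k → M) → (Fin G.k → M)
  | [] => G.zero
  | x :: l => G.add x (listSum l)

/-- Sum of a finitely indexed family of elements. -/
noncomputable def univSum {ι : Type} [Fintype ι] (f : ι → (Fin G.k → M)) : Fin G.k → M :=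
  G.listSum ((Finset.univ : Finset ι).toList.map f)

/-- `S` is a subgroup of `G`. -/
def IsSubgroup (S : Set (Fin G.k → M)) : Prop :=
  S ⊆ G.carrier ∧ G.zero ∈ S ∧ (∀ x ∈ S, ∀ y ∈ S, G.add x y ∈ S) ∧ ∀ x ∈ S, G.neg x ∈ S

/-- The `n`-torsion subgroup `{x : n • x = 0}`. -/
def torsion (n : ℕ) : Set (Fin G.k → M) :=
  {x | x ∈ G.carrier ∧ G.nsmul n x = G.zero}

/-- The elements of `S` have no (nontrivial) torsion. -/
def TorsionFreeOn (S : Set (Fin G.k → M)) : Prop :=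
  ∀ x ∈ S, ∀ n : ℕ, G.nsmul (n + 1) x = G.zero → x = G.zero

/-- The group `G` is torsion-free. -/
def TorsionFree : Prop := G.TorsionFreeOn G.carrier

/-- The set `S` is the internal direct sum of the family `I` of subgroups of `G`:
every element of `S` is uniquely the sum of a family of elements of the `I i`. -/
def IsInternalDirectSumOn {ι : Type} [Fintype ι] (S : Set (Fin G.k → M))
    (I : ι → Set (Fin G.k → M)) : Prop :=
  (∀ i, G.IsSubgroup (I i) ∧ I i ⊆ S) ∧
  (∀ x ∈ S, ∃ f : ι → (Fin G.k → M), (∀ i, f i ∈ I i) ∧ G.univSum f = x) ∧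
  (∀ f g : ι → (Fin G.k → M), (∀ i, f i ∈ I i) → (∀ i, g i ∈ I i) →
    G.univSum f = G.univSum g → f = g)

/-- `G` is the internal direct sum of the family `I` of subgroups. -/
def IsInternalDirectSum {ι : Type} [Fintype ι] (I : ι → Set (Fin G.k → M)) : Prop :=
  G.IsInternalDirectSumOn G.carrier I

section Order

variable [LinearOrder M]

/-- `C` is the definably connected component of `0` in `G`, i.e. the largest
definably connected definable subgroup of `G`. -/
def IsZeroComponent (C : Set (Fin G.k → M)) : Prop :=
  G.IsSubgroup C ∧ Defin L M C ∧ DefConnected L M C ∧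
    ∀ D, G.IsSubgroup D → Defin L M D → DefConnected L M D → D ⊆ C

/-- `N` is the maximal definable torsion-free subgroup of `G`. -/
def IsMaxDefTorsionFree (N : Set (Fin G.k → M)) : Prop :=
  G.IsSubgroup N ∧ Defin L M N ∧ G.TorsionFreeOn N ∧
    ∀ D, G.IsSubgroup D → Defin L M D → G.TorsionFreeOn D → D ⊆ N

end Order

end DefAbGroup

namespace DefRing

variable {L : FirstOrder.Language} {M : Type} [L.Structure M] (R : DefRing L M)

/-- `R` is a null ring: all products vanish. -/
def IsNull : Prop := ∀ x ∈ R.carrier, ∀ y ∈ R.carrier, R.mul x y = R.zero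

/-- The multiplication of `R` restricted to `S` is trivial. -/
def NullOn (S : Set (Fin R.k → M)) : Prop := ∀ x ∈ S, ∀ y ∈ S, R.mul x y = R.zero

/-- The two-sided annihilator of `X` in `R`. -/
def annOf (X : Set (Fin R.k → M)) : Set (Fin R.k → M) :=
  {a | a ∈ R.carrier ∧ ∀ x ∈ X, R.mul a x = R.zero ∧ R.mul x a = R.zero}

/-- `Ann(R)`, the two-sided annihilator of `R`. -/
def ann : Set (Fin R.k → M) := R.annOf R.carrier

/-- `powSucc x n = x^(n+1)`. -/
def powSucc (x : Fin R.k → M) : ℕ → (Fin R.k → M)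
  | 0 => x
  | n + 1 => R.mul (powSucc x n) x

/-- `upow e x n = x^n`, where `x^0 = e` (for a unital ring with identity `e`). -/
def upow (e x : Fin R.k → M) : ℕ → (Fin R.k → M)
  | 0 => e
  | n + 1 => R.mul (upow e x n) x

/-- `products S n` is the set of all products of `n` elements of `S` (for `n ≥ 1`;
by convention `products S 0 = {0}`). -/
def products (S : Set (Fin R.k → M)) : ℕ → Set (Fin R.k → M)
  | 0 => {R.zero}
  | 1 => S
  | n + 2 => {z | ∃ x ∈ S, ∃ y ∈ products S (n + 1), z = R.mul x y}

/-- `R` is a nilpotent ring: all products of some fixed length vanish. -/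
def IsNilpotentRing : Prop := ∃ m, 1 ≤ m ∧ R.products R.carrier m = {R.zero}

/-- `R` is a nil ring: every element is nilpotent. -/
def IsNilRing : Prop := ∀ x ∈ R.carrier, ∃ m : ℕ, R.powSucc x m = R.zero

/-- The set `I` is nilpotent: all products of some fixed length of elements of `I` vanish. -/
def NilpotentSet (I : Set (Fin R.k → M)) : Prop := ∃ m, 1 ≤ m ∧ R.products I m = {R.zero}

/-- `I` is a left ideal of `R`. -/
def IsLeftIdeal (I : Set (Fin R.k → M)) : Prop :=
  R.IsSubgroup I ∧ ∀ r ∈ R.carrier, ∀ x ∈ I, R.mul r x ∈ I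

/-- `I` is a right ideal of `R`. -/
def IsRightIdeal (I : Set (Fin R.k → M)) : Prop :=
  R.IsSubgroup I ∧ ∀ r ∈ R.carrier, ∀ x ∈ I, R.mul x r ∈ I

/-- `I` is a two-sided ideal of `R`. -/
def IsIdeal (I : Set (Fin R.k → M)) : Prop :=
  R.IsSubgroup I ∧ ∀ r ∈ R.carrier, ∀ x ∈ I, R.mul r x ∈ I ∧ R.mul x r ∈ I

/-- The Jacobson radical of `R`:
`J(R) = {a ∈ R : ∀ r ∈ R, ∃ b ∈ R, b·r·a − r·a − b = 0}`. -/
def jacobson : Set (Fin R.k → M) :=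
  {a | a ∈ R.carrier ∧ ∀ r ∈ R.carrier, ∃ b ∈ R.carrier,
    R.add (R.mul (R.mul b r) a) (R.add (R.neg (R.mul r a)) (R.neg b)) = R.zero}

/-- `R` is semiprime: `{0}` is its only nilpotent two-sided ideal. -/
def IsSemiprime : Prop := ∀ I, R.IsIdeal I → R.NilpotentSet I → I = {R.zero}

/-- `R` is prime: `aRb ≠ {0}` whenever `a, b ≠ 0`. -/
def IsPrimeRing : Prop := ∀ a ∈ R.carrier, a ≠ R.zero → ∀ b ∈ R.carrier, b ≠ R.zero →
    ∃ r ∈ R.carrier, R.mul (R.mul a r) b ≠ R.zero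

/-- `R` is simple: nontrivial multiplication and no nontrivial proper two-sided ideals. -/
def IsSimple : Prop := (¬ R.IsNull) ∧ ∀ I, R.IsIdeal I → I = {R.zero} ∨ I = R.carrier

/-- `R` is definably simple: nontrivial multiplication and no nontrivial proper
*definable* two-sided ideals. -/
def IsDefSimple : Prop :=
  (¬ R.IsNull) ∧ ∀ I, R.IsIdeal I → Defin L M I → I = {R.zero} ∨ I = R.carrier

/-- `e` is a (two-sided) multiplicative identity of `R`. -/
def IsIdentity (e : Fin R.k → M) : Prop :=
  e ∈ R.carrier ∧ ∀ x ∈ R.carrier, R.mul e x = x ∧ R.mul x e = x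

/-- `R` is unital. -/
def IsUnital : Prop := ∃ e, R.IsIdentity e

/-- `R` is a division ring. -/
def IsDivisionRing : Prop :=
  ∃ e, R.IsIdentity e ∧ e ≠ R.zero ∧ ∀ x ∈ R.carrier, x ≠ R.zero →
    ∃ y ∈ R.carrier, R.mul x y = e ∧ R.mul y x = e

theorem IsDivisionRing.unital {R : DefRing L M} (h : R.IsDivisionRing) : R.IsUnital :=
  h.imp fun _ he => he.1

/-- `S` is a subring (as a subset, not necessarily definable). -/
def IsSubringSet (S : Set (Fin R.k → M)) : Prop :=
  S ⊆ R.carrier ∧ R.zero ∈ S ∧ (∀ x ∈ S, ∀ y ∈ S, R.add x y ∈ S) ∧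
    (∀ x ∈ S, R.neg x ∈ S) ∧ ∀ x ∈ S, ∀ y ∈ S, R.mul x y ∈ S

/-- `S` is a definable subring of `R`. -/
def IsDefSubring (S : Set (Fin R.k → M)) : Prop :=
  Defin L M S ∧ R.IsSubringSet S

/-- `S` is the smallest definable subring of `R` containing `x`. -/
def IsSmallestDefSubringContaining (x : Fin R.k → M) (S : Set (Fin R.k → M)) : Prop :=
  R.IsDefSubring S ∧ x ∈ S ∧ ∀ T, R.IsDefSubring T → x ∈ T → S ⊆ T

/-- `e` is an idempotent element of `R`. -/
def IsIdempotent (e : Fin R.k → M) : Prop := e ∈ R.carrier ∧ R.mul e e = e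

/-- `a` and `b` are orthogonal: `a·b = b·a = 0`. -/
def Orthogonal (a b : Fin R.k → M) : Prop := R.mul a b = R.zero ∧ R.mul b a = R.zero

/-- `e` is a primitive idempotent: a nonzero idempotent that is not the sum of two
nonzero orthogonal idempotents. -/
def IsPrimitiveIdempotent (e : Fin R.k → M) : Prop :=
  R.IsIdempotent e ∧ e ≠ R.zero ∧
    ¬ ∃ a b, R.IsIdempotent a ∧ R.IsIdempotent b ∧ a ≠ R.zero ∧ b ≠ R.zero ∧
      R.Orthogonal a b ∧ R.add a b = e

/-- The set `R·e`. -/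
def leftMulSet (e : Fin R.k → M) : Set (Fin R.k → M) :=
  {z | ∃ r ∈ R.carrier, z = R.mul r e}

/-- The set `e·R`. -/
def rightMulSet (e : Fin R.k → M) : Set (Fin R.k → M) :=
  {z | ∃ r ∈ R.carrier, z = R.mul e r}

/-- The set `e·R·f`. -/
def midMulSet (e f : Fin R.k → M) : Set (Fin R.k → M) :=
  {z | ∃ r ∈ R.carrier, z = R.mul e (R.mul r f)}

/-- `I` is a minimal left ideal. -/
def IsMinimalLeftIdeal (I : Set (Fin R.k → M)) : Prop :=
  R.IsLeftIdeal I ∧ I ≠ {R.zero} ∧ ∀ J, R.IsLeftIdeal J → J ⊆ I → J = {R.zero} ∨ J = I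

/-- `I` is a minimal right ideal. -/
def IsMinimalRightIdeal (I : Set (Fin R.k → M)) : Prop :=
  R.IsRightIdeal I ∧ I ≠ {R.zero} ∧ ∀ J, R.IsRightIdeal J → J ⊆ I → J = {R.zero} ∨ J = I

/-- `R` is left Artinian: every descending chain of left ideals stabilizes. -/
def LeftArtinian : Prop :=
  ∀ f : ℕ → Set (Fin R.k → M), (∀ n, R.IsLeftIdeal (f n)) → (∀ n, f (n + 1) ⊆ f n) →
    ∃ N, ∀ n, N ≤ n → f n = f N

/-- `J` is a two-sided ideal of the (sub)ring `S`. -/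
def IsIdealOn (S J : Set (Fin R.k → M)) : Prop :=
  J ⊆ S ∧ R.zero ∈ J ∧ (∀ x ∈ J, ∀ y ∈ J, R.add x y ∈ J) ∧ (∀ x ∈ J, R.neg x ∈ J) ∧
    ∀ r ∈ S, ∀ x ∈ J, R.mul r x ∈ J ∧ R.mul x r ∈ J

/-- The (sub)ring `S` is a simple ring. -/
def SimpleOn (S : Set (Fin R.k → M)) : Prop :=
  (¬ R.NullOn S) ∧ ∀ J, R.IsIdealOn S J → J = {R.zero} ∨ J = S

/-- The (sub)ring `S` is a division ring. -/
def DivisionOn (S : Set (Fin R.k → M)) : Prop :=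
  ∃ e ∈ S, e ≠ R.zero ∧ (∀ x ∈ S, R.mul e x = x ∧ R.mul x e = x) ∧
    ∀ x ∈ S, x ≠ R.zero → ∃ y ∈ S, R.mul x y = e ∧ R.mul y x = e

/-- `R` is a (commutative) field. -/
def IsFieldRing : Prop :=
  (∀ x ∈ R.carrier, ∀ y ∈ R.carrier, R.mul x y = R.mul y x) ∧
  ∃ e, R.IsIdentity e ∧ e ≠ R.zero ∧
    ∀ x ∈ R.carrier, x ≠ R.zero → ∃ y ∈ R.carrier, R.mul x y = e

/-- Evaluation of the polynomial `∑_{i ≤ n} c i * X^i` at `x` (`e` the identity). -/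
def polyEval (e x : Fin R.k → M) (c : ℕ → (Fin R.k → M)) (n : ℕ) : Fin R.k → M :=
  R.listSum ((List.range (n + 1)).map fun i => R.mul (c i) (R.upow e x i))

/-- `R` is a real closed field: a field together with a linear order making it an
ordered field in which nonnegative elements are squares and every odd-degree polynomial
has a root. -/
def IsRealClosedDefField : Prop :=
  R.IsFieldRing ∧
  ∃ e, R.IsIdentity e ∧
  ∃ lt : (Fin R.k → M) → (Fin R.k → M) → Prop,
    (∀ x ∈ R.carrier, ¬ lt x x) ∧
    (∀ x ∈ R.carrier, ∀ y ∈ R.carrier, ∀ z ∈ R.carrier, lt x y → lt y z → lt x z) ∧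
    (∀ x ∈ R.carrier, ∀ y ∈ R.carrier, x ≠ y → lt x y ∨ lt y x) ∧
    (∀ x ∈ R.carrier, ∀ y ∈ R.carrier, ∀ z ∈ R.carrier, lt x y →
      lt (R.add x z) (R.add y z)) ∧
    (∀ x ∈ R.carrier, ∀ y ∈ R.carrier, lt R.zero x → lt R.zero y → lt R.zero (R.mul x y)) ∧
    (∀ x ∈ R.carrier, ¬ lt x R.zero → ∃ y ∈ R.carrier, R.mul y y = x) ∧
    (∀ n : ℕ, Odd n → ∀ c : ℕ → (Fin R.k → M), (∀ i, i ≤ n → c i ∈ R.carrier) →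
      c n ≠ R.zero → ∃ x ∈ R.carrier, R.polyEval e x c n = R.zero)

end DefRing

/-- A definable isomorphism of definable rings: a ring isomorphism whose graph is
definable. -/
def DefIso {L : FirstOrder.Language} {M : Type} [L.Structure M] (A B : DefRing L M) : Prop :=
  ∃ f : (Fin A.k → M) → (Fin B.k → M),
    Set.BijOn f A.carrier B.carrier ∧
    (∀ x ∈ A.carrier, ∀ y ∈ A.carrier,
      f (A.add x y) = B.add (f x) (f y) ∧ f (A.mul x y) = B.mul (f x) (f y)) ∧
    Defin L M {p : (Fin A.k ⊕ Fin B.k) → M |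
      (fun i => p (Sum.inl i)) ∈ A.carrier ∧
      f (fun i => p (Sum.inl i)) = fun i => p (Sum.inr i)}

end OMin
namespace OMin

/-- The language of rings with only the two binary operations `+` and `·`. -/
def ringLang : FirstOrder.Language :=
  ⟨fun n => match n with | 2 => Bool | _ => Empty, fun _ => Empty⟩

namespace DefRing

variable {L : FirstOrder.Language} {M : Type} [L.Structure M] (R : DefRing L M)

/-- The ring structure `(R, +, ·)` as a first-order structure on the carrier of `R`. -/
def innerStr : ringLang.Structure ↥R.carrier where
  funMap {n} f x :=
    match n, f, x with
    | 2, b, x =>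
      if (show Bool from b) then ⟨R.add ↑(x 0) ↑(x 1), R.add_mem _ (x 0).2 _ (x 1).2⟩
      else ⟨R.mul ↑(x 0) ↑(x 1), R.mul_mem _ (x 0).2 _ (x 1).2⟩
    | 0, f, _ => f.elim
    | 1, f, _ => f.elim
    | _ + 3, f, _ => f.elim
  RelMap {n} r _ := r.elim

/-- A set of tuples from the carrier of `R` that is definable in the pure ring
structure `(R, +, ·)`. -/
def InnerDefinable {α : Type} (S : Set (α → ↥R.carrier)) : Prop :=
  letI := R.innerStr
  Set.Definable (Set.univ : Set ↥R.carrier) ringLang S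

/-- A subset of `R` that is definable in the pure ring structure `(R, +, ·)`. -/
def InnerDefinableSubset (S : Set (Fin R.k → M)) : Prop :=
  S ⊆ R.carrier ∧
    R.InnerDefinable {x : Fin 1 → ↥R.carrier | ((x 0 : ↥R.carrier) : Fin R.k → M) ∈ S}

variable {R}

theorem add_zero' {x : Fin R.k → M} (hx : x ∈ R.carrier) : R.add x R.zero = x := by
  rw [R.hadd_comm x hx R.zero R.zero_mem]; exact R.hzero_add x hx

theorem add_neg' {x : Fin R.k → M} (hx : x ∈ R.carrier) : R.add x (R.neg x) = R.zero := by
  rw [R.hadd_comm x hx (R.neg x) (R.neg_mem x hx)]; exact R.hneg_add x hx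

theorem add_left_cancel' {a b c : Fin R.k → M}
    (ha : a ∈ R.carrier) (hb : b ∈ R.carrier) (hc : c ∈ R.carrier)
    (h : R.add a b = R.add a c) : b = c := by
  have hna := R.neg_mem a ha
  calc b = R.add R.zero b := (R.hzero_add b hb).symm
    _ = R.add (R.add (R.neg a) a) b := by rw [R.hneg_add a ha]
    _ = R.add (R.neg a) (R.add a b) := R.hadd_assoc _ hna _ ha _ hb
    _ = R.add (R.neg a) (R.add a c) := by rw [h]
    _ = R.add (R.add (R.neg a) a) c := (R.hadd_assoc _ hna _ ha _ hc).symm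
    _ = R.add R.zero c := by rw [R.hneg_add a ha]
    _ = c := R.hzero_add c hc

theorem zero_mul' {x : Fin R.k → M} (hx : x ∈ R.carrier) : R.mul R.zero x = R.zero := by
  have h0 := R.zero_mem
  have hm := R.mul_mem _ h0 _ hx
  apply add_left_cancel' hm hm h0
  calc R.add (R.mul R.zero x) (R.mul R.zero x)
      = R.mul (R.add R.zero R.zero) x := (R.hright_distrib _ h0 _ h0 _ hx).symm
    _ = R.mul R.zero x := by rw [R.hzero_add _ h0]
    _ = R.add (R.mul R.zero x) R.zero := (add_zero' hm).symm

theorem mul_zero' {x : Fin R.k → M} (hx : x ∈ R.carrier) : R.mul x R.zero = R.zero := by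
  have h0 := R.zero_mem
  have hm := R.mul_mem _ hx _ h0
  apply add_left_cancel' hm hm h0
  calc R.add (R.mul x R.zero) (R.mul x R.zero)
      = R.mul x (R.add R.zero R.zero) := (R.hleft_distrib _ hx _ h0 _ h0).symm
    _ = R.mul x R.zero := by rw [R.hzero_add _ h0]
    _ = R.add (R.mul x R.zero) R.zero := (add_zero' hm).symm

variable (R)

/-- The addition on the carrier of a definable ring. -/
def addSub : Add ↥R.carrier := ⟨fun a b => ⟨R.add a b, R.add_mem _ a.2 _ b.2⟩⟩

/-- The zero of the carrier of a definable ring. -/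
def zeroSub : Zero ↥R.carrier := ⟨⟨R.zero, R.zero_mem⟩⟩

/-- The negation on the carrier of a definable ring. -/
def negSub : Neg ↥R.carrier := ⟨fun a => ⟨R.neg a, R.neg_mem _ a.2⟩⟩

/-- The unital ring structure on the carrier of a unital definable ring. -/
noncomputable def ringSub (h : R.IsUnital) : Ring ↥R.carrier := by
  letI := R.addSub; letI := R.zeroSub; letI := R.negSub
  exact
  { add := fun a b => ⟨R.add a b, R.add_mem _ a.2 _ b.2⟩
    add_assoc := fun a b c => Subtype.ext (R.hadd_assoc _ a.2 _ b.2 _ c.2)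
    zero := ⟨R.zero, R.zero_mem⟩
    zero_add := fun a => Subtype.ext (R.hzero_add _ a.2)
    add_zero := fun a => Subtype.ext (add_zero' a.2)
    add_comm := fun a b => Subtype.ext (R.hadd_comm _ a.2 _ b.2)
    neg := fun a => ⟨R.neg a, R.neg_mem _ a.2⟩
    neg_add_cancel := fun a => Subtype.ext (R.hneg_add _ a.2)
    nsmul := nsmulRec
    zsmul := zsmulRec
    mul := fun a b => ⟨R.mul a b, R.mul_mem _ a.2 _ b.2⟩
    mul_assoc := fun a b c => Subtype.ext (R.hmul_assoc _ a.2 _ b.2 _ c.2)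
    one := ⟨Classical.choose h, (Classical.choose_spec h).1⟩
    one_mul := fun a => Subtype.ext (((Classical.choose_spec h).2 _ a.2).1)
    mul_one := fun a => Subtype.ext (((Classical.choose_spec h).2 _ a.2).2)
    left_distrib := fun a b c => Subtype.ext (R.hleft_distrib _ a.2 _ b.2 _ c.2)
    right_distrib := fun a b c => Subtype.ext (R.hright_distrib _ a.2 _ b.2 _ c.2)
    zero_mul := fun a => Subtype.ext (zero_mul' a.2)
    mul_zero := fun a => Subtype.ext (mul_zero' a.2)
    nsmul_zero := fun a => rfl
    nsmul_succ := fun n a => rfl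
    zsmul_zero' := fun a => rfl
    zsmul_succ' := fun n a => rfl
    zsmul_neg' := fun n a => rfl }

theorem IsFieldRing.unital {R : DefRing L M} (h : R.IsFieldRing) : R.IsUnital :=
  h.2.imp fun _ he => he.1

/-- The commutative ring structure on the carrier of a definable field. -/
noncomputable def commRingSub (h : R.IsFieldRing) : CommRing ↥R.carrier :=
  { R.ringSub h.unital with
    mul_comm := fun a b => by exact Subtype.ext (h.1 _ a.2 _ b.2) }

end DefRing

end OMin
namespace OMin

/-- `K(√-1)`: the quadratic extension `K[X]/(X² + 1)` of `K`, realized concretely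
on pairs. -/
structure Gauss (K : Type) where
  re : K
  im : K

namespace Gauss

variable {K : Type} [CommRing K]

@[ext] theorem ext {a b : Gauss K} (h1 : a.re = b.re) (h2 : a.im = b.im) : a = b := by
  cases a; cases b; cases h1; cases h2; rfl

instance : Add (Gauss K) := ⟨fun a b => ⟨a.re + b.re, a.im + b.im⟩⟩
instance : Mul (Gauss K) := ⟨fun a b => ⟨a.re * b.re - a.im * b.im, a.re * b.im + a.im * b.re⟩⟩
instance : Neg (Gauss K) := ⟨fun a => ⟨-a.re, -a.im⟩⟩
instance : Zero (Gauss K) := ⟨⟨0, 0⟩⟩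
instance : One (Gauss K) := ⟨⟨1, 0⟩⟩

@[simp] theorem add_re (a b : Gauss K) : (a + b).re = a.re + b.re := rfl
@[simp] theorem add_im (a b : Gauss K) : (a + b).im = a.im + b.im := rfl
@[simp] theorem mul_re (a b : Gauss K) : (a * b).re = a.re * b.re - a.im * b.im := rfl
@[simp] theorem mul_im (a b : Gauss K) : (a * b).im = a.re * b.im + a.im * b.re := rfl
@[simp] theorem neg_re (a : Gauss K) : (-a).re = -a.re := rfl
@[simp] theorem neg_im (a : Gauss K) : (-a).im = -a.im := rfl
@[simp] theorem zero_re : (0 : Gauss K).re = 0 := rfl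
@[simp] theorem zero_im : (0 : Gauss K).im = 0 := rfl
@[simp] theorem one_re : (1 : Gauss K).re = 1 := rfl
@[simp] theorem one_im : (1 : Gauss K).im = 0 := rfl

instance : CommRing (Gauss K) where
  add := (· + ·)
  add_assoc a b c := by ext <;> simp <;> ring
  zero := 0
  zero_add a := by ext <;> simp
  add_zero a := by ext <;> simp
  add_comm a b := by ext <;> simp <;> ring
  neg := Neg.neg
  neg_add_cancel a := by ext <;> simp
  nsmul := nsmulRec
  zsmul := zsmulRec
  mul := (· * ·)
  mul_assoc a b c := by ext <;> simp <;> ring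
  one := 1
  one_mul a := by ext <;> simp
  mul_one a := by ext <;> simp
  left_distrib a b c := by ext <;> simp <;> ring
  right_distrib a b c := by ext <;> simp <;> ring
  zero_mul a := by ext <;> simp
  mul_zero a := by ext <;> simp
  mul_comm a b := by ext <;> simp <;> ring

end Gauss

variable {L : FirstOrder.Language} {M : Type} [L.Structure M]

/-- An abstract field `F` isomorphic (as a ring, via `iso`) to the definable field `K`,
together with a finite-dimensional associative `F`-algebra `A` with nontrivial
multiplication and a (set-level) ring isomorphism `aiso` from the subring `S` of the
definable ring `R` onto `A`. -/
structure AlgebraCopy (K : DefRing L M) (R : DefRing L M) (S : Set (Fin R.k → M)) where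
  F : Type
  [fieldF : Field F]
  iso : (Fin K.k → M) → F
  bij : Set.BijOn iso K.carrier Set.univ
  map_add : ∀ x ∈ K.carrier, ∀ y ∈ K.carrier, iso (K.add x y) = iso x + iso y
  map_mul : ∀ x ∈ K.carrier, ∀ y ∈ K.carrier, iso (K.mul x y) = iso x * iso y
  A : Type
  [ringA : NonUnitalRing A]
  [moduleA : Module F A]
  [towerA : IsScalarTower F A A]
  [commA : SMulCommClass F A A]
  findim : FiniteDimensional F A
  notNull : ∃ a b : A, a * b ≠ 0
  aiso : (Fin R.k → M) → A
  abij : Set.BijOn aiso S Set.univ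
  amap_add : ∀ x ∈ S, ∀ y ∈ S, aiso (R.add x y) = aiso x + aiso y
  amap_mul : ∀ x ∈ S, ∀ y ∈ S, aiso (R.mul x y) = aiso x * aiso y

/-- The (abstract) ring `A` has nontrivial multiplication, i.e. is not a null ring. -/
def NotNullCarrier (A : Type) [NonUnitalRing A] : Prop := ∃ a b : A, a * b ≠ 0

/-- A finite-dimensional associative `F`-algebra `A` and a ring isomorphism from the
definable ring `R` onto the direct product `A × B`, for a definable ring `B`. -/
structure ProdSplit (F : Type) [Field F] (R : DefRing L M) (B : DefRing L M) where
  A : Type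
  [ringA : NonUnitalRing A]
  [moduleA : Module F A]
  [towerA : IsScalarTower F A A]
  [commA : SMulCommClass F A A]
  findim : FiniteDimensional F A
  f : (Fin R.k → M) → A × (Fin B.k → M)
  bij : Set.BijOn f R.carrier {p | p.2 ∈ B.carrier}
  map_add : ∀ x ∈ R.carrier, ∀ y ∈ R.carrier,
    f (R.add x y) = ((f x).1 + (f y).1, B.add (f x).2 (f y).2)
  map_mul : ∀ x ∈ R.carrier, ∀ y ∈ R.carrier,
    f (R.mul x y) = ((f x).1 * (f y).1, B.mul (f x).2 (f y).2)

/-- `D` (a definable ring in `M`) is a copy, via the canonical flattening of tuples,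
of the ring `Din`, which is definable in the pure ring structure `(B, +, ·)`. -/
def IsInnerCopy (B : DefRing L M) (Din : @DefRing ringLang ↥B.carrier B.innerStr)
    (D : DefRing L M) : Prop :=
  letI := B.innerStr
  ∃ e : Fin D.k ≃ (Fin Din.k × Fin B.k),
    ∃ g : (Fin Din.k → ↥B.carrier) → (Fin D.k → M),
      (∀ x i, g x i = (x (e i).1 : Fin B.k → M) (e i).2) ∧
      Set.BijOn g Din.carrier D.carrier ∧
      ∀ x ∈ Din.carrier, ∀ y ∈ Din.carrier,
        g (Din.add x y) = D.add (g x) (g y) ∧ g (Din.mul x y) = D.mul (g x) (g y)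

/-- `R` is definably isomorphic to the ring `M_n(D)` of `n × n` matrices over the
definable division ring `D`. -/
def MatrixIso (R D : DefRing L M) (hD : D.IsUnital) (n : ℕ) : Prop :=
  letI := D.ringSub hD
  ∃ f : (Fin R.k → M) → Matrix (Fin n) (Fin n) ↥D.carrier,
    Set.BijOn f R.carrier Set.univ ∧
    (∀ x ∈ R.carrier, ∀ y ∈ R.carrier,
      f (R.add x y) = f x + f y ∧ f (R.mul x y) = f x * f y) ∧
    Defin L M {p : (Fin R.k ⊕ Fin n × Fin n × Fin D.k) → M |
      (fun i => p (Sum.inl i)) ∈ R.carrier ∧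
      ∀ q : Fin n × Fin n × Fin D.k,
        ((f (fun i => p (Sum.inl i)) q.1 q.2.1 : ↥D.carrier) : Fin D.k → M) q.2.2 =
          p (Sum.inr q)}

/-- A definable scalar multiplication of the definable field `K` on the subset `S` of the
definable ring `R` making `S` a definable `K`-vector space. -/
def IsDefVectorSpaceOn (K R : DefRing L M) (S : Set (Fin R.k → M))
    (σ : (Fin K.k → M) → (Fin R.k → M) → (Fin R.k → M)) : Prop :=
  (∀ c ∈ K.carrier, ∀ x ∈ S, σ c x ∈ S) ∧
  Defin L M {p : (Fin K.k ⊕ Fin R.k ⊕ Fin R.k) → M |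
    (fun i => p (Sum.inl i)) ∈ K.carrier ∧ (fun i => p (Sum.inr (Sum.inl i))) ∈ S ∧
    σ (fun i => p (Sum.inl i)) (fun i => p (Sum.inr (Sum.inl i))) =
      fun i => p (Sum.inr (Sum.inr i))} ∧
  (∀ e, K.IsIdentity e → ∀ x ∈ S, σ e x = x) ∧
  (∀ c ∈ K.carrier, ∀ x ∈ S, ∀ y ∈ S, σ c (R.add x y) = R.add (σ c x) (σ c y)) ∧
  (∀ c ∈ K.carrier, ∀ d ∈ K.carrier, ∀ x ∈ S, σ (K.add c d) x = R.add (σ c x) (σ d x)) ∧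
  (∀ c ∈ K.carrier, ∀ d ∈ K.carrier, ∀ x ∈ S, σ (K.mul c d) x = σ c (σ d x))

/-- The subring `S` of `R` is a definable `K`-vector space and a definable associative
`K`-algebra. -/
def IsDefAlgebraOn (K R : DefRing L M) (S : Set (Fin R.k → M)) : Prop :=
  ∃ σ, IsDefVectorSpaceOn K R S σ ∧
    ∀ r ∈ K.carrier, ∀ s ∈ K.carrier, ∀ u ∈ S, ∀ v ∈ S,
      R.mul (σ r u) (σ s v) = σ (K.mul r s) (R.mul u v)

/-- `S` (a subring of the definable ring `R`) is definably isomorphic to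
`K^r × K(√-1)^p × ℍ(K)^q`, for the definable field `K`. -/
def GaussQuatIso (R : DefRing L M) (S : Set (Fin R.k → M)) (K : DefRing L M)
    (hK : K.IsFieldRing) (r p q : ℕ) : Prop :=
  letI := K.commRingSub hK
  ∃ f : (Fin R.k → M) →
      ((Fin r → ↥K.carrier) × (Fin p → Gauss ↥K.carrier) × (Fin q → Quaternion ↥K.carrier)),
    Set.BijOn f S Set.univ ∧
    (∀ x ∈ S, ∀ y ∈ S, f (R.add x y) = f x + f y ∧ f (R.mul x y) = f x * f y) ∧
    Defin L M {pp : (Fin R.k ⊕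
        ((Fin r × Fin K.k) ⊕ (Fin p × Fin 2 × Fin K.k) ⊕ (Fin q × Fin 4 × Fin K.k))) → M |
      (fun i => pp (Sum.inl i)) ∈ S ∧
      (∀ (a : Fin r) (c : Fin K.k),
        (((f (fun i => pp (Sum.inl i))).1 a : Fin K.k → M)) c =
          pp (Sum.inr (Sum.inl (a, c)))) ∧
      (∀ (a : Fin p) (c : Fin K.k),
        ((((f (fun i => pp (Sum.inl i))).2.1 a).re : Fin K.k → M)) c =
            pp (Sum.inr (Sum.inr (Sum.inl (a, 0, c)))) ∧
        ((((f (fun i => pp (Sum.inl i))).2.1 a).im : Fin K.k → M)) c =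
            pp (Sum.inr (Sum.inr (Sum.inl (a, 1, c))))) ∧
      (∀ (a : Fin q) (c : Fin K.k),
        ((((f (fun i => pp (Sum.inl i))).2.2 a).re : Fin K.k → M)) c =
            pp (Sum.inr (Sum.inr (Sum.inr (a, 0, c)))) ∧
        ((((f (fun i => pp (Sum.inl i))).2.2 a).imI : Fin K.k → M)) c =
            pp (Sum.inr (Sum.inr (Sum.inr (a, 1, c)))) ∧
        ((((f (fun i => pp (Sum.inl i))).2.2 a).imJ : Fin K.k → M)) c =
            pp (Sum.inr (Sum.inr (Sum.inr (a, 2, c)))) ∧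
        ((((f (fun i => pp (Sum.inl i))).2.2 a).imK : Fin K.k → M)) c =
            pp (Sum.inr (Sum.inr (Sum.inr (a, 3, c)))))}

end OMin
namespace OMin

section Tame

variable {M : Type} [LinearOrder M]

/-- Membership in `T` is constant on every closed interval disjoint from `F`. -/
def Decides (F T : Set M) : Prop :=
  ∀ x y, x ≤ y → (∀ z ∈ F, x ≤ z → ¬ z ≤ y) → (x ∈ T ↔ y ∈ T)

/-- `T` is a finite union of points and intervals: membership in `T` is decided by the
position relative to a finite set. -/
def Tame (T : Set M) : Prop := ∃ F : Set M, F.Finite ∧ Decides F T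

/-- The points in no neighbourhood of which membership in `T` is constant. -/
def bdry (T : Set M) : Set M :=
  {s | ∀ a b, a < s → s < b → ∃ x, a < x ∧ x < b ∧ ¬ (x ∈ T ↔ s ∈ T)}

theorem Decides.mono {F G T : Set M} (h : Decides F T) (hFG : F ⊆ G) : Decides G T :=
  fun x y hxy hz => h x y hxy fun z hzF => hz z (hFG hzF)

theorem Decides.dual {F T : Set M} (h : Decides F T) :
    Decides (OrderDual.ofDual ⁻¹' F) (OrderDual.ofDual ⁻¹' T) :=
  fun x y hxy hz => (h y.ofDual x.ofDual hxy fun z hzF h1 h2 =>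
    hz (OrderDual.toDual z) hzF h2 h1).symm

theorem Tame.dual {T : Set M} (h : Tame T) : Tame (OrderDual.ofDual ⁻¹' T) := by
  obtain ⟨F, hF, hd⟩ := h
  exact ⟨_, hF.preimage OrderDual.ofDual.injective.injOn, hd.dual⟩

theorem tame_iUnion {n : ℕ} {t : Fin n → Set M} (h : ∀ i, Tame (t i)) : Tame (⋃ i, t i) := by
  choose F hF hd using h
  refine ⟨⋃ i, F i, Set.finite_iUnion hF, fun x y hxy hz => ?_⟩
  simp only [Set.mem_iUnion]
  exact exists_congr fun i => (hd i).mono (Set.subset_iUnion F i) x y hxy hz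

theorem IsPointOrInterval.tame {s : Set M} (h : IsPointOrInterval M s) : Tame s := by
  rcases h with ⟨a, rfl⟩ | ⟨a, b, rfl⟩ | ⟨a, rfl⟩ | ⟨a, rfl⟩ | rfl
  · refine ⟨{a}, Set.finite_singleton a, fun x y hxy hz => ?_⟩
    have := hz a rfl
    simp only [Set.mem_singleton_iff]
    grind
  · refine ⟨{a, b}, by simp, fun x y hxy hz => ?_⟩
    have := hz a (by simp)
    have := hz b (by simp)
    simp only [Set.mem_Ioo]
    grind
  · refine ⟨{a}, Set.finite_singleton a, fun x y hxy hz => ?_⟩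
    have := hz a rfl
    simp only [Set.mem_Ioi]
    grind
  · refine ⟨{a}, Set.finite_singleton a, fun x y hxy hz => ?_⟩
    have := hz a rfl
    simp only [Set.mem_Iio]
    grind
  · exact ⟨∅, Set.finite_empty, fun x y hxy hz => by simp⟩

theorem exists_finite_meets {F : Set M} (hF : F.Finite) :
    ∃ K : Set M, K.Finite ∧ ∀ T, Decides F T → T.Infinite → ∃ r ∈ K, r ∈ T := by
  obtain ⟨K, hK, hbij⟩ := Set.exists_subset_bijOn Fᶜ (fun x => {z ∈ F | z < x})
  have hfin : ((fun x => {z ∈ F | z < x}) '' Fᶜ).Finite :=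
    hF.finite_subsets.subset (by rintro _ ⟨x, -, rfl⟩ z hz; exact hz.1)
  refine ⟨K, ?_, fun T hT hinf => ?_⟩
  · rw [← hbij.image_eq] at hfin
    exact hfin.of_finite_image hbij.injOn
  · obtain ⟨x, hxT, hxF⟩ := hinf.exists_notMem_finite hF
    obtain ⟨r, hr, hrx⟩ := hbij.surjOn ⟨x, hxF, rfl⟩
    have hrF : r ∉ F := hK hr
    have key : ∀ z ∈ F, z < r ↔ z < x := fun z hz => by
      have := Set.ext_iff.1 hrx z
      simpa [hz] using this
    refine ⟨r, hr, ?_⟩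
    rcases le_total r x with h | h
    · exact (hT r x h fun z hz h1 h2 => by
        have := key z hz
        have : z ≠ x := fun h => hxF (h ▸ hz)
        grind).2 hxT
    · exact (hT x r h fun z hz h1 h2 => by
        have := key z hz
        have : z ≠ r := fun h => hrF (h ▸ hz)
        grind).1 hxT

/-- There is no family of intervals `(u, c)` such that every `u` has right neighbours `c`
while every `c` belongs to only finitely many of the intervals. -/
theorem no_finite_overlaps [DenselyOrdered M] {P : M → M → Prop} {p q : M} (hpq : p < q)
    (h1 : ∀ u, p < u → u < q → ∃ c, u < c ∧ P u c)
    (h2 : ∀ u c c', P u c → u < c' → c' ≤ c → P u c')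
    (h3 : ∀ c, {u | p < u ∧ u < q ∧ u < c ∧ P u c}.Finite)
    (hB : ∃ r, p < r ∧
      ((∀ x, p < x → x < r → ∀ y, p < y → y < x → ∃ c, x < c ∧ P x c ∧ ¬ P y c) ∨
        ∀ x, p < x → x < r →
          ¬ ∀ y, p < y → y < x → ∃ c, x < c ∧ P x c ∧ ¬ P y c)) : False := by
  obtain ⟨r, hpr, hB⟩ := hB
  obtain ⟨u, hpu, hur⟩ := exists_between (lt_min hpr hpq)
  obtain ⟨c, huc, hPc⟩ := h1 u hpu (hur.trans_le (min_le_right _ _))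
  obtain ⟨c', huc', hc'⟩ := exists_between (lt_min huc hur)
  have hcc : c' < c := hc'.trans_le (min_le_left _ _)
  have hcr : c' < r := hc'.trans_le ((min_le_right _ _).trans (min_le_left _ _))
  have hcq : c' < q := hc'.trans_le ((min_le_right _ _).trans (min_le_right _ _))
  have hPc' : P u c' := h2 u c c' hPc huc' hcc.le
  rcases hB with hB | hB
  · refine (Set.Ioo_infinite huc') ((h3 c').subset fun x hx => ?_)
    have hpx := hpu.trans hx.1
    refine ⟨hpx, hx.2.trans hcq, hx.2, ?_⟩
    obtain ⟨d, hxd, hPd, hnd⟩ := hB x hpx (hx.2.trans hcr) u hpu hx.1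
    have : c' < d := by
      by_contra! hle
      exact hnd (h2 u c' d hPc' (hx.1.trans hxd) hle)
    exact h2 x d c' hPd hx.2 this.le
  · obtain ⟨x, ⟨hpx, hxq, hxc, hPx⟩, hmin⟩ :=
      Set.exists_min_image _ id (h3 c') ⟨u, hpu, huc'.trans hcq, huc', hPc'⟩
    refine hB x hpx (hxc.trans hcr) fun y hpy hyx => ⟨c', hxc, hPx, fun hPy => ?_⟩
    exact not_lt.2 (hmin y ⟨hpy, hyx.trans hxq, hyx.trans hxc, hPy⟩) hyx

theorem Tame.decides_bdry [DenselyOrdered M] {T : Set M} (h : Tame T) : Decides (bdry T) T := by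
  obtain ⟨F, hF, hd⟩ := h
  have hd' : Decides (F ∪ bdry T) T := hd.mono Set.subset_union_left
  clear hd
  induction F, hF using Set.Finite.induction_on with
  | empty => simpa using hd'
  | @insert f G _ _ ih =>
    refine ih ?_
    by_cases hf : f ∈ bdry T
    · refine hd'.mono ?_
      rintro z ((rfl | hz) | hz)
      exacts [Or.inr hf, Or.inl hz, Or.inr hz]
    simp only [bdry, Set.mem_ofPred_eq, not_forall, not_exists, not_and, not_not] at hf
    obtain ⟨a, b, ha, hb, hab⟩ := hf
    have left : ∀ x, x ≤ f → (∀ z ∈ G ∪ bdry T, x ≤ z → ¬ z ≤ f) → (x ∈ T ↔ f ∈ T) := by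
      intro x hxf hz
      rcases hxf.eq_or_lt with rfl | hxf
      · rfl
      obtain ⟨x', hx', hxf'⟩ := exists_between (max_lt ha hxf)
      have h1 := (le_max_left _ _).trans_lt hx'
      have h2 := (le_max_right _ _).trans_lt hx'
      refine (hd' x x' h2.le ?_).trans (hab x' h1 (hxf'.trans hb))
      rintro z ((rfl | hzG) | hzT) hxz hzx
      · exact absurd hzx (not_le.2 hxf')
      · exact hz z (Or.inl hzG) hxz (hzx.trans hxf'.le)
      · exact hz z (Or.inr hzT) hxz (hzx.trans hxf'.le)
    have right : ∀ y, f ≤ y → (∀ z ∈ G ∪ bdry T, f ≤ z → ¬ z ≤ y) → (f ∈ T ↔ y ∈ T) := by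
      intro y hfy hz
      rcases hfy.eq_or_lt with rfl | hfy
      · rfl
      obtain ⟨y', hfy', hy'⟩ := exists_between (lt_min hb hfy)
      have h1 := hy'.trans_le (min_le_left _ _)
      have h2 := hy'.trans_le (min_le_right _ _)
      refine (hab y' (ha.trans hfy') h1).symm.trans (hd' y' y h2.le ?_)
      rintro z ((rfl | hzG) | hzT) hyz hzy
      · exact absurd hyz (not_le.2 hfy')
      · exact hz z (Or.inl hzG) (hfy'.le.trans hyz) hzy
      · exact hz z (Or.inr hzT) (hfy'.le.trans hyz) hzy
    intro x y hxy hz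
    by_cases hfxy : x ≤ f ∧ f ≤ y
    · exact (left x hfxy.1 fun z hzG h1 h2 => hz z hzG h1 (h2.trans hfxy.2)).trans
        (right y hfxy.2 fun z hzG h1 h2 => hz z hzG (hfxy.1.trans h1) h2)
    · refine hd' x y hxy ?_
      rintro z ((rfl | hzG) | hzT) h1 h2
      · exact hfxy ⟨h1, h2⟩
      · exact hz z (Or.inl hzG) h1 h2
      · exact hz z (Or.inr hzT) h1 h2

variable [NoMinOrder M] [NoMaxOrder M]

theorem exists_Ioo_avoiding {F : Set M} (hF : F.Finite) (s : M) :
    ∃ a b, a < s ∧ s < b ∧ ∀ z ∈ F, a < z → z < b → z = s := by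
  induction F, hF using Set.Finite.induction_on with
  | empty =>
    obtain ⟨a, ha⟩ := exists_lt s
    obtain ⟨b, hb⟩ := exists_gt s
    exact ⟨a, b, ha, hb, by simp⟩
  | @insert f G _ _ ih =>
    obtain ⟨a, b, ha, hb, h⟩ := ih
    rcases lt_trichotomy f s with hf | hf | hf
    · refine ⟨max a f, b, max_lt ha hf, hb, fun z hz h1 h2 => ?_⟩
      rcases hz with rfl | hz
      · exact absurd h1 (not_lt.2 (le_max_right _ _))
      · exact h z hz ((le_max_left _ _).trans_lt h1) h2
    · refine ⟨a, b, ha, hb, fun z hz h1 h2 => ?_⟩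
      rcases hz with rfl | hz
      · exact hf
      · exact h z hz h1 h2
    · refine ⟨a, min b f, ha, lt_min hb hf, fun z hz h1 h2 => ?_⟩
      rcases hz with rfl | hz
      · exact absurd h2 (not_lt.2 (min_le_right _ _))
      · exact h z hz h1 (h2.trans_le (min_le_left _ _))

theorem Decides.bdry_subset {F T : Set M} (hF : F.Finite) (h : Decides F T) : bdry T ⊆ F := by
  intro s hs
  by_contra hsF
  obtain ⟨a, b, ha, hb, hab⟩ := exists_Ioo_avoiding hF s
  obtain ⟨x, hax, hxb, hx⟩ := hs a b ha hb
  rcases le_total x s with hxs | hxs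
  · exact hx (h x s hxs fun z hz h1 h2 =>
      hsF (hab z hz (hax.trans_le h1) (h2.trans_lt hb) ▸ hz))
  · exact hx (h s x hxs fun z hz h1 h2 =>
      hsF (hab z hz (ha.trans_le h1) (h2.trans_lt hxb) ▸ hz)).symm

theorem Tame.finite_bdry {T : Set M} (h : Tame T) : (bdry T).Finite := by
  obtain ⟨F, hF, hd⟩ := h
  exact hF.subset (hd.bdry_subset hF)

theorem Tame.exists_Ioo_subset [DenselyOrdered M] {T : Set M} (h : Tame T) (hinf : T.Infinite) :
    ∃ a b, a < b ∧ ∀ x, a < x → x < b → x ∈ T := by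
  obtain ⟨x, hxT, hx⟩ := hinf.exists_notMem_finite h.finite_bdry
  simp only [bdry, Set.mem_ofPred_eq, not_forall, not_exists, not_and, not_not] at hx
  obtain ⟨a, b, ha, hb, hab⟩ := hx
  exact ⟨a, b, ha.trans hb, fun y h1 h2 => (hab y h1 h2).2 hxT⟩

theorem Tame.right_germ {T : Set M} (h : Tame T) (p : M) :
    ∃ r, p < r ∧ ((∀ x, p < x → x < r → x ∈ T) ∨ ∀ x, p < x → x < r → x ∉ T) := by
  obtain ⟨F, hF, hd⟩ := h
  obtain ⟨a, r, ha, hr, hF'⟩ := exists_Ioo_avoiding hF p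
  have key : ∀ x y, p < x → x ≤ y → y < r → (x ∈ T ↔ y ∈ T) := fun x y hpx hxy hyr =>
    hd x y hxy fun z hz h1 h2 => by
      have := hF' z hz (ha.trans (hpx.trans_le h1)) (h2.trans_lt hyr)
      exact absurd (hpx.trans_le h1) (by simp [this])
  refine ⟨r, hr, ?_⟩
  by_cases hex : ∃ x, p < x ∧ x < r ∧ x ∈ T
  · obtain ⟨x, hpx, hxr, hxT⟩ := hex
    left
    intro y hpy hyr
    rcases le_total x y with hxy | hxy
    · exact (key x y hpx hxy hyr).1 hxT
    · exact (key y x hpy hxy hxr).2 hxT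
  · right
    exact fun x h1 h2 h3 => hex ⟨x, h1, h2, h3⟩

theorem Tame.left_germ {T : Set M} (h : Tame T) (p : M) :
    ∃ r, r < p ∧ ((∀ x, x < p → r < x → x ∈ T) ∨ ∀ x, x < p → r < x → x ∉ T) :=
  h.dual.right_germ (OrderDual.toDual p)

end Tame

end OMin
namespace OMin

/-- Types whose elements are finite tuples from `M`. -/
class Tup (M Γ : Type) where
  ι : Type
  fin : Finite ι
  e : Γ ≃ (ι → M)

attribute [instance] Tup.fin

namespace Tup

variable {M : Type}

instance self : Tup M M where
  ι := Unit
  fin := inferInstance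
  e := (Equiv.funUnique Unit M).symm

instance pi {ι : Type} [Finite ι] : Tup M (ι → M) where
  ι := ι
  fin := inferInstance
  e := Equiv.refl _

instance prod {Γ Δ : Type} [Tup M Γ] [Tup M Δ] : Tup M (Γ × Δ) where
  ι := Tup.ι M Γ ⊕ Tup.ι M Δ
  fin := inferInstance
  e := (Equiv.prodCongr e e).trans (Equiv.sumArrowEquivProdArrow _ _ _).symm

end Tup

section Coord

variable {M : Type} {Γ Δ Θ : Type} [Tup M Γ] [Tup M Δ] [Tup M Θ]

/-- A map of tuples that only permutes, repeats and forgets coordinates. -/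
@[fun_prop]
def Coord (M : Type) {Γ Δ : Type} [Tup M Γ] [Tup M Δ] (f : Γ → Δ) : Prop :=
  ∃ σ : Tup.ι M Δ → Tup.ι M Γ, ∀ g, Tup.e (f g) = Tup.e g ∘ σ

@[fun_prop]
theorem Coord.id : Coord M (fun g : Γ => g) := ⟨_root_.id, fun _ => rfl⟩

@[fun_prop]
theorem Coord.comp {f : Δ → Θ} {h : Γ → Δ} (hf : Coord M f) (hh : Coord M h) :
    Coord M (fun g => f (h g)) := by
  obtain ⟨σ, hσ⟩ := hf
  obtain ⟨τ, hτ⟩ := hh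
  exact ⟨τ ∘ σ, fun g => by rw [hσ, hτ]; rfl⟩

@[fun_prop]
theorem Coord.fst {f : Γ → Δ × Θ} (hf : Coord M f) : Coord M (fun g => (f g).1) :=
  Coord.comp (f := Prod.fst) ⟨Sum.inl, fun _ => rfl⟩ hf

@[fun_prop]
theorem Coord.snd {f : Γ → Δ × Θ} (hf : Coord M f) : Coord M (fun g => (f g).2) :=
  Coord.comp (f := Prod.snd) ⟨Sum.inr, fun _ => rfl⟩ hf

@[fun_prop]
theorem Coord.prodMk {f : Γ → Δ} {h : Γ → Θ} (hf : Coord M f) (hh : Coord M h) :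
    Coord M (fun g => (f g, h g)) := by
  obtain ⟨σ, hσ⟩ := hf
  obtain ⟨τ, hτ⟩ := hh
  refine ⟨Sum.elim σ τ, fun g => ?_⟩
  funext i
  rcases i with i | i
  · exact congrFun (hσ g) i
  · exact congrFun (hτ g) i

@[fun_prop]
theorem Coord.cons {n : ℕ} {f : Γ → M} {h : Γ → Fin n → M} (hf : Coord M f) (hh : Coord M h) :
    Coord M (fun g => (Fin.cons (f g) (h g) : Fin (n + 1) → M)) := by
  obtain ⟨σ, hσ⟩ := hf
  obtain ⟨τ, hτ⟩ := hh
  refine ⟨Fin.cons (σ ()) τ, fun g => ?_⟩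
  funext i
  refine Fin.cases ?_ (fun i => ?_) i
  · exact congrFun (hσ g) ()
  · exact congrFun (hτ g) i

end Coord

section Df

variable {L : FirstOrder.Language} {M : Type} [L.Structure M]
variable {Γ Δ : Type} [Tup M Γ] [Tup M Δ]

/-- A predicate on tuples from `M` is definable. -/
def Df (L : FirstOrder.Language) (M : Type) [L.Structure M] {Γ : Type} [Tup M Γ]
    (P : Γ → Prop) : Prop :=
  Defin L M {v : Tup.ι M Γ → M | P (Tup.e.symm v)}

theorem Df.comp {P : Δ → Prop} (hP : Df L M P) {f : Γ → Δ} (hf : Coord M f) :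
    Df L M (fun g => P (f g)) := by
  obtain ⟨σ, hσ⟩ := hf
  have h := Set.Definable.preimage_comp σ hP
  refine (congrArg (Defin L M) ?_).mp h
  ext v
  change P (Tup.e.symm (v ∘ σ)) ↔ P (f (Tup.e.symm v))
  have : Tup.e.symm (v ∘ σ) = f (Tup.e.symm v) := by
    rw [Equiv.symm_apply_eq, hσ, Equiv.apply_symm_apply]
  rw [this]

theorem Df.congr {P Q : Γ → Prop} (hP : Df L M P) (h : ∀ g, Q g ↔ P g) : Df L M Q := by
  have : Q = P := funext fun g => propext (h g)
  rwa [this]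

theorem Df.and {P Q : Γ → Prop} (hP : Df L M P) (hQ : Df L M Q) : Df L M (fun g => P g ∧ Q g) :=
  Set.Definable.inter hP hQ

theorem Df.or {P Q : Γ → Prop} (hP : Df L M P) (hQ : Df L M Q) : Df L M (fun g => P g ∨ Q g) :=
  Set.Definable.union hP hQ

theorem Df.not {P : Γ → Prop} (hP : Df L M P) : Df L M (fun g => ¬ P g) :=
  Set.Definable.compl hP

theorem Df.imp {P Q : Γ → Prop} (hP : Df L M P) (hQ : Df L M Q) : Df L M (fun g => P g → Q g) :=
  (hP.not.or hQ).congr fun _ => imp_iff_not_or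

theorem Df.iff {P Q : Γ → Prop} (hP : Df L M P) (hQ : Df L M Q) :
    Df L M (fun g => P g ↔ Q g) :=
  ((hP.imp hQ).and (hQ.imp hP)).congr fun _ => iff_def

theorem Df.ex {P : Γ → Δ → Prop} (hP : Df L M (fun p : Γ × Δ => P p.1 p.2)) :
    Df L M (fun g => ∃ d, P g d) := by
  have h := Set.Definable.exists_of_finite (β := Tup.ι M Δ) hP
  refine (congrArg (Defin L M) ?_).mp h
  ext v
  change (∃ u, P (Tup.e.symm v) (Tup.e.symm u)) ↔ _
  exact Tup.e.symm.exists_congr_left.trans (by simp)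

theorem Df.all {P : Γ → Δ → Prop} (hP : Df L M (fun p : Γ × Δ => P p.1 p.2)) :
    Df L M (fun g => ∀ d, P g d) :=
  (Df.ex (P := fun g d => ¬ P g d) hP.not).not.congr fun _ => by simp

theorem df_const (p : Prop) : Df L M (fun _ : Γ => p) := by
  by_cases hp : p
  · exact (congrArg (Defin L M) (by ext; simp [hp])).mp Set.definable_univ
  · exact (congrArg (Defin L M) (by ext; simp [hp])).mp Set.definable_empty

theorem df_eq_const (c : Γ) : Df L M (fun g : Γ => g = c) := by
  have h : ∀ i, Defin L M {v : Tup.ι M Γ → M | v i = Tup.e c i} := fun i =>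
    Set.Definable.preimage_comp (fun _ : Fin 1 => i)
      (Set.Definable.singleton_of_mem L (Set.mem_univ (Tup.e c i)))
  refine (congrArg (Defin L M) ?_).mp (Set.definable_iInter_of_finite h)
  ext v
  simp only [Set.mem_iInter, Set.mem_ofPred_eq]
  rw [← funext_iff, Equiv.symm_apply_eq]

theorem Df.fix {P : Γ → Δ → Prop} (hP : Df L M (fun p : Γ × Δ => P p.1 p.2)) (d : Δ) :
    Df L M (fun g => P g d) :=
  (Df.ex (P := fun g d' => d' = d ∧ P g d')
    (((df_eq_const d).comp (f := Prod.snd (α := Γ)) (Coord.snd Coord.id)).and hP)).congr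
    fun _ => by simp

theorem Df.fixLeft {P : Γ → Δ → Prop} (hP : Df L M (fun p : Γ × Δ => P p.1 p.2)) (g : Γ) :
    Df L M (fun d => P g d) :=
  Df.fix (P := fun d g => P g d) (hP.comp (f := fun p : Δ × Γ => (p.2, p.1)) (by fun_prop)) g

end Df

/-- The properties of an o-minimal structure, as instances and with definability expressed by
`Df`. -/
class IsOMin (L : FirstOrder.Language) (M : Type) [L.Structure M] [LinearOrder M] : Prop where
  dense : DenselyOrdered M
  noMin : NoMinOrder M
  noMax : NoMaxOrder M
  df_lt : Df L M (fun p : M × M => p.1 < p.2)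
  tame : ∀ {P : M → Prop}, Df L M P → Tame {x | P x}

section

variable {L : FirstOrder.Language} {M : Type} [L.Structure M] [LinearOrder M]
variable {Γ Δ : Type} [Tup M Γ] [Tup M Δ]

theorem OMinimal.isOMin (h : OMinimal L M) : IsOMin L M := by
  obtain ⟨h1, h2, h3, -, h4, h5⟩ := h
  refine ⟨h1, h2, h3, ?_, fun {P} hP => ?_⟩
  · exact Set.Definable.preimage_comp ![Sum.inl (), Sum.inr ()] h4
  · obtain ⟨n, t, ht, hs⟩ := h5 {x | P x} (Set.Definable.preimage_comp (fun _ : Unit => (0 : Fin 1)) hP)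
    rw [hs]
    exact tame_iUnion fun i => (ht i).tame

theorem Df.lt [IsOMin L M] {f h : Γ → M} (hf : Coord M f) (hh : Coord M h) :
    Df L M (fun g => f g < h g) :=
  (IsOMin.df_lt (L := L)).comp (hf.prodMk hh)

theorem infinite_iff_exists_Ioo [IsOMin L M] {P : M → Prop} (hP : Df L M P) :
    {x | P x}.Infinite ↔ ∃ a b, a < b ∧ ∀ x, a < x → x < b → P x := by
  have := IsOMin.dense L (M := M)
  have := IsOMin.noMin L (M := M)
  have := IsOMin.noMax L (M := M)
  refine ⟨(IsOMin.tame hP).exists_Ioo_subset, ?_⟩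
  rintro ⟨a, b, hab, h⟩
  exact (Set.Ioo_infinite hab).mono fun x hx => h x hx.1 hx.2

theorem Df.inf [IsOMin L M] {P : Γ → M → Prop} (hP : Df L M (fun p : Γ × M => P p.1 p.2)) :
    Df L M (fun g => {t | P g t}.Infinite) := by
  refine Df.congr ?_ fun g => infinite_iff_exists_Ioo (L := L) (hP.fixLeft g)
  refine Df.ex (Df.ex ((Df.lt (by fun_prop) (by fun_prop)).and (Df.all ((Df.lt ?_ ?_).imp
    ((Df.lt ?_ ?_).imp (hP.comp (f := fun p : ((Γ × M) × M) × M => (p.1.1.1, p.2)) ?_))))))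
  all_goals fun_prop

theorem Df.bdry [IsOMin L M] {P : Γ → M → Prop} (hP : Df L M (fun p : Γ × M => P p.1 p.2)) :
    Df L M (fun p : Γ × M => p.2 ∈ bdry {t | P p.1 t}) := by
  refine Df.all (Df.all (Df.imp (Df.lt ?_ ?_) (Df.imp (Df.lt ?_ ?_) (Df.ex ((Df.lt ?_ ?_).and
    ((Df.lt ?_ ?_).and (Df.not (Df.iff
      (hP.comp (f := fun p : (((Γ × M) × M) × M) × M => (p.1.1.1.1, p.2)) ?_)
      (hP.comp (f := fun p : (((Γ × M) × M) × M) × M => p.1.1.1) ?_)))))))))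
  all_goals fun_prop

end

end OMin
namespace OMin

section Exchange

theorem bdry_dual {M : Type} [LinearOrder M] (T : Set M) :
    bdry (OrderDual.ofDual ⁻¹' T) = OrderDual.ofDual ⁻¹' bdry T := by
  ext s
  exact ⟨fun h a b ha hb => (h (OrderDual.toDual b) (OrderDual.toDual a) hb ha).imp
      fun x hx => ⟨hx.2.1, hx.1, hx.2.2⟩,
    fun h a b ha hb => (h b.ofDual a.ofDual hb ha).imp fun x hx => ⟨hx.2.1, hx.1, hx.2.2⟩⟩

/-- In a family of sets such that every point lies in only finitely many of them, only finitely
many points are left endpoints of members of the family. -/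
theorem finite_left_endpoints {M Y : Type} [LinearOrder M] [DenselyOrdered M] [NoMinOrder M]
    [NoMaxOrder M] {X : Y → M → Prop} (hX : ∀ x, {y | X y x}.Finite)
    (hb : ∀ y, (bdry {x | X y x}).Finite) {P : M → M → Prop}
    (hP : ∀ u c, P u c ↔ ∃ y, u ∈ bdry {x | X y x} ∧ ∀ z, u < z → z ≤ c → X y z)
    (hU : Tame {u | ∃ c, u < c ∧ P u c})
    (hB : ∀ p, Tame {x | ∀ y, p < y → y < x → ∃ c, x < c ∧ P x c ∧ ¬ P y c}) :
    {u | ∃ c, u < c ∧ P u c}.Finite := by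
  by_contra hinf
  obtain ⟨p, q, hpq, hsub⟩ := hU.exists_Ioo_subset hinf
  refine no_finite_overlaps (P := P) hpq hsub ?_ ?_ ((hB p).right_germ p)
  · intro u c c' hPc hu hc
    obtain ⟨y, hy, h⟩ := (hP u c).1 hPc
    exact (hP u c').2 ⟨y, hy, fun z h1 h2 => h z h1 (h2.trans hc)⟩
  · intro c
    refine ((hX c).biUnion fun y _ => hb y).subset ?_
    rintro u ⟨-, -, huc, hPc⟩
    obtain ⟨y, hy, h⟩ := (hP u c).1 hPc
    exact Set.mem_biUnion (show y ∈ {y | X y c} from h c huc le_rfl) hy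

variable {L : FirstOrder.Language} {M : Type} [L.Structure M] [LinearOrder M] [IsOMin L M]

/-- In a definable family of open sets such that every point lies in only finitely many of them,
only finitely many points are boundary points of members of the family. -/
theorem finite_iUnion_bdry {X : M → M → Prop} (hX : Df L M (fun p : M × M => X p.1 p.2))
    (hfin : ∀ x, {y | X y x}.Finite)
    (hopen : ∀ y x, X y x → ∃ a b, a < x ∧ x < b ∧ ∀ z, a < z → z < b → X y z) :
    (⋃ y, bdry {x | X y x}).Finite := by
  have := IsOMin.dense L (M := M)
  have := IsOMin.noMin L (M := M)
  have := IsOMin.noMax L (M := M)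
  have ht : ∀ y, Tame {x | X y x} := fun y => IsOMin.tame (hX.fixLeft y)
  have hb := fun y => (ht y).finite_bdry
  have dP : Df L M (fun p : M × M => ∃ y, p.1 ∈ bdry {x | X y x} ∧
      ∀ z, p.1 < z → (¬ p.2 < z) → X y z) := by
    refine Df.ex (Df.and (hX.bdry.comp (f := fun p : (M × M) × M => (p.2, p.1.1)) ?_)
      (Df.all (Df.imp (Df.lt ?_ ?_) (Df.imp (Df.lt ?_ ?_).not
        (hX.comp (f := fun p : ((M × M) × M) × M => (p.1.2, p.2)) ?_)))))
    all_goals fun_prop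
  have dP' : Df L M (fun p : M × M => ∃ y, p.1 ∈ bdry {x | X y x} ∧
      ∀ z, z < p.1 → (¬ z < p.2) → X y z) := by
    refine Df.ex (Df.and (hX.bdry.comp (f := fun p : (M × M) × M => (p.2, p.1.1)) ?_)
      (Df.all (Df.imp (Df.lt ?_ ?_) (Df.imp (Df.lt ?_ ?_).not
        (hX.comp (f := fun p : ((M × M) × M) × M => (p.1.2, p.2)) ?_)))))
    all_goals fun_prop
  have tU : Tame {u | ∃ c, u < c ∧ ∃ y, u ∈ bdry {x | X y x} ∧
      ∀ z, u < z → (¬ c < z) → X y z} := by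
    refine IsOMin.tame (L := L) (Df.ex (Df.and (Df.lt ?_ ?_) dP))
    all_goals fun_prop
  have tB : ∀ p, Tame {x | ∀ y, p < y → y < x → ∃ c, x < c ∧
      (∃ w, x ∈ bdry {x | X w x} ∧ ∀ z, x < z → (¬ c < z) → X w z) ∧
      ¬ (∃ w, y ∈ bdry {x | X w x} ∧ ∀ z, y < z → (¬ c < z) → X w z)} := by
    intro p
    refine IsOMin.tame (L := L) (Df.fix (d := p) (P := fun x p => ∀ y, p < y → y < x →
      ∃ c, x < c ∧
      (∃ w, x ∈ bdry {x | X w x} ∧ ∀ z, x < z → (¬ c < z) → X w z) ∧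
      ¬ (∃ w, y ∈ bdry {x | X w x} ∧ ∀ z, y < z → (¬ c < z) → X w z))
      (Df.all (Df.imp (Df.lt ?_ ?_) (Df.imp (Df.lt ?_ ?_) (Df.ex (Df.and (Df.lt ?_ ?_) (Df.and
        (dP.comp (f := fun p : ((M × M) × M) × M => (p.1.1.1, p.2)) ?_)
        (dP.comp (f := fun p : ((M × M) × M) × M => (p.1.2, p.2)) ?_).not)))))))
    all_goals fun_prop
  have tU' : Tame {u | ∃ c, c < u ∧ ∃ y, u ∈ bdry {x | X y x} ∧
      ∀ z, z < u → (¬ z < c) → X y z} := by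
    refine IsOMin.tame (L := L) (Df.ex (Df.and (Df.lt ?_ ?_) dP'))
    all_goals fun_prop
  have tB' : ∀ p, Tame {x | ∀ y, y < p → x < y → ∃ c, c < x ∧
      (∃ w, x ∈ bdry {x | X w x} ∧ ∀ z, z < x → (¬ z < c) → X w z) ∧
      ¬ (∃ w, y ∈ bdry {x | X w x} ∧ ∀ z, z < y → (¬ z < c) → X w z)} := by
    intro p
    refine IsOMin.tame (L := L) (Df.fix (d := p) (P := fun x p => ∀ y, y < p → x < y →
      ∃ c, c < x ∧
      (∃ w, x ∈ bdry {x | X w x} ∧ ∀ z, z < x → (¬ z < c) → X w z) ∧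
      ¬ (∃ w, y ∈ bdry {x | X w x} ∧ ∀ z, z < y → (¬ z < c) → X w z))
      (Df.all (Df.imp (Df.lt ?_ ?_) (Df.imp (Df.lt ?_ ?_) (Df.ex (Df.and (Df.lt ?_ ?_) (Df.and
        (dP'.comp (f := fun p : ((M × M) × M) × M => (p.1.1.1, p.2)) ?_)
        (dP'.comp (f := fun p : ((M × M) × M) × M => (p.1.2, p.2)) ?_).not)))))))
    all_goals fun_prop
  have h1 := finite_left_endpoints hfin hb
    (P := fun u c => ∃ y, u ∈ bdry {x | X y x} ∧ ∀ z, u < z → (¬ c < z) → X y z)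
    (by simp only [not_lt, implies_true]) tU tB
  have h2 := finite_left_endpoints (M := Mᵒᵈ) (X := fun y x => X y x.ofDual) hfin
    (fun y => (ht y).dual.finite_bdry)
    (P := fun u c => ∃ y, u.ofDual ∈ bdry {x | X y x} ∧
      ∀ z, z < u.ofDual → (¬ z < c.ofDual) → X y z)
    (fun u c => by
      change (∃ y, u.ofDual ∈ bdry {x | X y x} ∧ _) ↔
        ∃ y, u ∈ bdry (OrderDual.ofDual ⁻¹' {x | X y x}) ∧ _
      simp only [bdry_dual, not_lt]
      rfl)
    tU'.dual (fun p => (tB' p.ofDual).dual)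
  refine (h1.union (h2.preimage OrderDual.toDual.injective.injOn)).subset fun u hu => ?_
  obtain ⟨y, hy⟩ := Set.mem_iUnion.1 hu
  have huX : ¬ X y u := fun huX => by
    obtain ⟨a, b, ha, hb, hab⟩ := hopen y u huX
    obtain ⟨x, hx1, hx2, hx⟩ := hy a b ha hb
    exact hx ⟨fun _ => huX, fun _ => hab x hx1 hx2⟩
  obtain ⟨r, hr, hr'⟩ := (ht y).right_germ u
  obtain ⟨l, hl, hl'⟩ := (ht y).left_germ u
  rcases hr' with hr' | hr'
  · left
    obtain ⟨c, hc, hc'⟩ := exists_between hr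
    exact ⟨c, hc, y, hy, fun z h1 h2 => hr' z h1 ((not_lt.1 h2).trans_lt hc')⟩
  rcases hl' with hl' | hl'
  · right
    obtain ⟨c, hc, hc'⟩ := exists_between hl
    exact ⟨OrderDual.toDual c, hc', y, hy, fun z h1 h2 => hl' z h1 (hc.trans_le (not_lt.1 h2))⟩
  exfalso
  obtain ⟨x, hx1, hx2, hx⟩ := hy l r hl hr
  refine hx (iff_of_false ?_ huX)
  rcases lt_trichotomy x u with h | rfl | h
  exacts [hl' x h hx1, huX, hr' x h hx2]

/-- The quantifier for infinitely many commutes with itself on definable relations. -/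
theorem infinite_exchange {X : M → M → Prop} (hX : Df L M (fun p : M × M => X p.1 p.2))
    (h : {y | {x | X y x}.Infinite}.Infinite) : {x | {y | X y x}.Infinite}.Infinite := by
  have := IsOMin.dense L (M := M)
  have := IsOMin.noMin L (M := M)
  have := IsOMin.noMax L (M := M)
  intro hK
  have hXs : Df L M (fun p : M × M => X p.2 p.1) :=
    hX.comp (f := fun p : M × M => (p.2, p.1)) (by fun_prop)
  set X' : M → M → Prop := fun y x => X y x ∧ ¬ {y | X y x}.Infinite with hX'
  have dX' : Df L M (fun p : M × M => X' p.1 p.2) :=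
    hX.and (((Df.inf (P := fun x y => X y x) hXs).comp (f := fun p : M × M => p.2)
      (by fun_prop)).not)
  set X1 : M → M → Prop := fun y x => ∃ a b, a < x ∧ x < b ∧ ∀ z, a < z → z < b → X' y z with hX1
  have dX1 : Df L M (fun p : M × M => X1 p.1 p.2) := by
    refine Df.ex (Df.ex (Df.and (Df.lt ?_ ?_) (Df.and (Df.lt ?_ ?_) (Df.all (Df.imp (Df.lt ?_ ?_)
      (Df.imp (Df.lt ?_ ?_) (dX'.comp (f := fun p : (((M × M) × M) × M) × M =>
        (p.1.1.1.1, p.2)) ?_)))))))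
    all_goals fun_prop
  have hfin : ∀ x, {y | X1 y x}.Finite := by
    intro x
    by_cases hx : {y | X y x}.Infinite
    · refine Set.finite_empty.subset ?_
      rintro y ⟨a, b, ha, hb, hab⟩
      exact (hab x ha hb).2 hx
    · refine (Set.not_infinite.1 hx).subset ?_
      rintro y ⟨a, b, ha, hb, hab⟩
      exact (hab x ha hb).1
  have hopen : ∀ y x, X1 y x → ∃ a b, a < x ∧ x < b ∧ ∀ z, a < z → z < b → X1 y z := by
    rintro y x ⟨a, b, ha, hb, hab⟩
    exact ⟨a, b, ha, hb, fun z h1 h2 => ⟨a, b, h1, h2, hab⟩⟩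
  have hbd := finite_iUnion_bdry dX1 hfin hopen
  obtain ⟨K, hKf, hKm⟩ := exists_finite_meets hbd
  refine h ((hKf.biUnion fun x _ => hfin x).subset fun y hy => ?_)
  have h' : {x | X' y x}.Infinite := by
    refine (hy.sdiff hK).mono ?_
    rintro x ⟨h1, h2⟩
    exact ⟨h1, h2⟩
  obtain ⟨a, b, hab, hsub⟩ := (IsOMin.tame (dX'.fixLeft y)).exists_Ioo_subset h'
  have h'' : {x | X1 y x}.Infinite :=
    (Set.Ioo_infinite hab).mono fun x hx => ⟨a, b, hx.1, hx.2, hsub⟩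
  obtain ⟨r, hrK, hr⟩ := hKm _ ((IsOMin.tame (dX1.fixLeft y)).decides_bdry.mono
    (Set.subset_iUnion (fun y => bdry {x | X1 y x}) y)) h''
  exact Set.mem_biUnion hrK hr

/-- A definable family of infinite subsets of `M` such that every point lies in only finitely many
of them is finite, where the members of the family are counted by means of a map `κ`. -/
theorem finite_image_of_finite_fibres {Γ K : Type} [Tup M Γ] {Y : Γ → Prop} {T : Γ → M → Prop}
    (hY : Df L M Y) (hT : Df L M (fun p : Γ × M => T p.1 p.2)) (κ : Γ → K)
    (hκ : ∀ y y', Y y → Y y' → κ y = κ y' → T y = T y') (hinf : ∀ y, Y y → {t | T y t}.Infinite)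
    (hfin : ∀ t, (κ '' {y | Y y ∧ T y t}).Finite) : (κ '' {y | Y y}).Finite := by
  have := IsOMin.dense L (M := M)
  have := IsOMin.noMin L (M := M)
  have := IsOMin.noMax L (M := M)
  have ht : ∀ y, Tame {t | T y t} := fun y => IsOMin.tame (hT.fixLeft y)
  have hbdt : ∀ t, {s | ∃ y, Y y ∧ s ∈ bdry {t | T y t} ∧ T y t}.Finite := by
    intro t
    obtain ⟨Z, hZ, hbij⟩ := Set.exists_subset_bijOn {y | Y y ∧ T y t} κ
    have hZf : Z.Finite := by
      have := hfin t
      rw [← hbij.image_eq] at this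
      exact this.of_finite_image hbij.injOn
    refine (hZf.biUnion fun y _ => (ht y).finite_bdry).subset ?_
    rintro s ⟨y, hy, hs, hyt⟩
    obtain ⟨z, hz, hzy⟩ := hbij.surjOn ⟨y, ⟨hy, hyt⟩, rfl⟩
    refine Set.mem_biUnion hz ?_
    rwa [hκ z y (hZ hz).1 hy hzy]
  have hbd : {s | ∃ y, Y y ∧ s ∈ bdry {t | T y t}}.Finite := by
    by_contra hbd
    have dR : Df L M (fun p : M × M => ∃ y, Y y ∧ p.1 ∈ bdry {t | T y t} ∧ T y p.2) := by
      refine Df.ex (Df.and (hY.comp (f := fun p : (M × M) × Γ => p.2) ?_)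
        (Df.and (hT.bdry.comp (f := fun p : (M × M) × Γ => (p.2, p.1.1)) ?_)
          (hT.comp (f := fun p : (M × M) × Γ => (p.2, p.1.2)) ?_)))
      all_goals fun_prop
    have := infinite_exchange (X := fun s t => ∃ y, Y y ∧ s ∈ bdry {t | T y t} ∧ T y t) dR
      (Set.Infinite.mono (by
        rintro s ⟨y, hy, hs⟩
        exact (hinf y hy).mono fun t h => ⟨y, hy, hs, h⟩) hbd)
    obtain ⟨t, h⟩ := this.nonempty
    exact h (hbdt t)
  obtain ⟨J, hJ, hJm⟩ := exists_finite_meets hbd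
  refine (hJ.biUnion fun t _ => hfin t).subset ?_
  rintro _ ⟨y, hy, rfl⟩
  obtain ⟨r, hr, hr'⟩ := hJm _ ((ht y).decides_bdry.mono fun s hs => ⟨y, hy, hs⟩) (hinf y hy)
  exact Set.mem_biUnion hr ⟨y, ⟨hy, hr'⟩, rfl⟩

end Exchange

end OMin
namespace OMin

section Dimension

variable {M : Type}

/-- If `F t d` says that the fibre over `t` has dimension at least `d`, then `liftDim F d` says
that the total space of the fibration over `M` has dimension at least `d`. -/
def liftDim (F : M → ℕ → Prop) (d : ℕ) : Prop :=
  (∃ t, F t d) ∨ ∃ d', d = d' + 1 ∧ {t | F t d'}.Infinite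

/-- If `F v d` says that the fibre over `v` has dimension at least `d`, then `iterDim F d` says
that the total space of the fibration over `M ^ n` has dimension at least `d`. -/
def iterDim : {n : ℕ} → ((Fin n → M) → ℕ → Prop) → ℕ → Prop
  | 0, F => F Fin.elim0
  | _ + 1, F => liftDim fun t => iterDim fun v => F (Fin.cons t v)

/-- The set `X` of `n`-tuples has dimension at least `d`, computed one coordinate at a time. -/
def FibDimGE {n : ℕ} (X : (Fin n → M) → Prop) (d : ℕ) : Prop :=
  iterDim (fun v d => d = 0 ∧ X v) d

theorem liftDim_add {F G : M → ℕ → Prop} {p : ℕ} (h : ∀ t d, F t d → G t (d + p)) {d : ℕ}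
    (hF : liftDim F d) : liftDim G (d + p) := by
  rcases hF with ⟨t, ht⟩ | ⟨d', rfl, ht⟩
  · exact Or.inl ⟨t, h t d ht⟩
  · exact Or.inr ⟨d' + p, by omega, ht.mono fun t ht => h t d' ht⟩

theorem iterDim_add {n : ℕ} {F G : (Fin n → M) → ℕ → Prop} {p : ℕ}
    (h : ∀ v d, F v d → G v (d + p)) {d : ℕ} (hF : iterDim F d) : iterDim G (d + p) := by
  induction n generalizing d with
  | zero => exact h _ d hF
  | succ n ih => exact liftDim_add (fun t d ht => ih (fun v d hv => h _ d hv) ht) hF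

theorem iterDim_mono {n : ℕ} {F G : (Fin n → M) → ℕ → Prop}
    (h : ∀ v d, F v d → G v d) {d : ℕ} (hF : iterDim F d) : iterDim G d :=
  iterDim_add (p := 0) h hF

theorem iterDim_sub {n : ℕ} {F G : (Fin n → M) → ℕ → Prop} {q : ℕ}
    (h : ∀ v d, F v d → G v (d - q)) {d : ℕ} (hF : iterDim F d) : iterDim G (d - q) := by
  induction n generalizing d with
  | zero => exact h _ d hF
  | succ n ih =>
    have ih' : ∀ t d, iterDim (fun v => F (Fin.cons t v)) d →
        iterDim (fun v => G (Fin.cons t v)) (d - q) := fun t d ht => ih (fun v d hv => h _ d hv) ht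
    rcases hF with ⟨t, ht⟩ | ⟨d', rfl, ht⟩
    · exact Or.inl ⟨t, ih' t d ht⟩
    · by_cases hq : q ≤ d'
      · exact Or.inr ⟨d' - q, by omega, ht.mono fun t ht => ih' t d' ht⟩
      · obtain ⟨t, ht⟩ := ht.nonempty
        have := ih' t d' ht
        rw [show d' - q = d' + 1 - q by omega] at this
        exact Or.inl ⟨t, this⟩

theorem iterDim_antitone {n : ℕ} {F : (Fin n → M) → ℕ → Prop}
    (h : ∀ v d, F v (d + 1) → F v d) {d : ℕ} (hF : iterDim F (d + 1)) : iterDim F d := by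
  induction n generalizing d with
  | zero => exact h _ d hF
  | succ n ih =>
    rcases hF with ⟨t, ht⟩ | ⟨d', hd, ht⟩
    · exact Or.inl ⟨t, ih (F := fun v => F (Fin.cons t v)) (fun v d hv => h _ d hv) ht⟩
    · obtain rfl : d = d' := by omega
      exact Or.inl ht.nonempty

theorem exists_of_iterDim {n : ℕ} {F : (Fin n → M) → ℕ → Prop} {d : ℕ} (hF : iterDim F d) :
    ∃ v d', F v d' := by
  induction n generalizing d with
  | zero => exact ⟨_, d, hF⟩
  | succ n ih =>
    have : ∃ t d', iterDim (fun v => F (Fin.cons t v)) d' := by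
      rcases hF with ⟨t, ht⟩ | ⟨d', -, ht⟩
      · exact ⟨t, d, ht⟩
      · obtain ⟨t, ht⟩ := ht.nonempty
        exact ⟨t, d', ht⟩
    obtain ⟨t, d', ht⟩ := this
    obtain ⟨v, d', h⟩ := ih ht
    exact ⟨_, d', h⟩

theorem iterDim_of_exists {n : ℕ} {F : (Fin n → M) → ℕ → Prop} {d : ℕ} {v : Fin n → M}
    (h : F v d) : iterDim F d := by
  induction n with
  | zero => rwa [Subsingleton.elim v Fin.elim0] at h
  | succ n ih => exact Or.inl ⟨v 0, ih (v := Fin.tail v) (by rwa [Fin.cons_self_tail])⟩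

theorem iterDim_or {n : ℕ} {F G H : (Fin n → M) → ℕ → Prop}
    (h : ∀ v d, F v d → G v d ∨ H v d) {d : ℕ} (hF : iterDim F d) :
    iterDim G d ∨ iterDim H d := by
  induction n generalizing d with
  | zero => exact h _ d hF
  | succ n ih =>
    have ih' : ∀ t d, iterDim (fun v => F (Fin.cons t v)) d → _ := fun t d ht =>
      ih (G := fun v => G (Fin.cons t v)) (H := fun v => H (Fin.cons t v))
        (fun v d hv => h _ d hv) ht
    rcases hF with ⟨t, ht⟩ | ⟨d', rfl, ht⟩
    · exact (ih' t d ht).imp (fun h => Or.inl ⟨t, h⟩) fun h => Or.inl ⟨t, h⟩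
    · have := ht.mono fun t ht => ih' t d' ht
      rcases Set.infinite_union.1 this with h | h
      · exact Or.inl (Or.inr ⟨d', rfl, h⟩)
      · exact Or.inr (Or.inr ⟨d', rfl, h⟩)

namespace FibDimGE

variable {n : ℕ} {X Y : (Fin n → M) → Prop} {d : ℕ}

theorem mono (h : ∀ v, X v → Y v) (hX : FibDimGE X d) : FibDimGE Y d :=
  iterDim_mono (fun v _ hv => ⟨hv.1, h v hv.2⟩) hX

theorem of_le {d' : ℕ} (h : FibDimGE X d) (hd : d' ≤ d) : FibDimGE X d' := by
  induction d, hd using Nat.le_induction with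
  | base => exact h
  | succ d _ ih => exact ih (iterDim_antitone (fun v d hv => by simp at hv) h)

theorem nonempty (h : FibDimGE X d) : ∃ v, X v :=
  (exists_of_iterDim h).imp fun _ ⟨_, h⟩ => h.2

theorem zero_of_mem {v : Fin n → M} (h : X v) : FibDimGE X 0 := iterDim_of_exists ⟨rfl, h⟩

theorem or (h : FibDimGE (fun v => X v ∨ Y v) d) : FibDimGE X d ∨ FibDimGE Y d :=
  iterDim_or (fun _ _ hv => hv.2.imp (⟨hv.1, ·⟩) (⟨hv.1, ·⟩)) h

theorem exists_of_finite {I : Type} {S : Set I} (hS : S.Finite) {Z : I → (Fin n → M) → Prop}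
    (h : FibDimGE (fun v => ∃ i ∈ S, Z i v) d) : ∃ i ∈ S, FibDimGE (Z i) d := by
  induction S, hS using Set.Finite.induction_on with
  | empty => simpa using h.nonempty
  | @insert i S _ _ ih =>
    rcases (h.mono (Y := fun v => Z i v ∨ ∃ j ∈ S, Z j v) (by simp)).or with h | h
    · exact ⟨i, by simp, h⟩
    · obtain ⟨j, hj, h⟩ := ih h
      exact ⟨j, by simp [hj], h⟩

theorem le (h : FibDimGE X d) : d ≤ n := by
  induction n generalizing d with
  | zero => exact h.1.le
  | succ n ih =>
    rcases h with ⟨t, ht⟩ | ⟨d', rfl, ht⟩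
    · exact (ih (X := fun v => X (Fin.cons t v)) ht).trans n.le_succ
    · obtain ⟨t, ht⟩ := ht.nonempty
      exact Nat.succ_le_succ (ih (X := fun v => X (Fin.cons t v)) ht)

theorem eq_zero_of_subsingleton (hX : ∀ v w, X v → X w → v = w) (h : FibDimGE X d) :
    d = 0 := by
  induction n generalizing d with
  | zero => exact h.1
  | succ n ih =>
    rcases h with ⟨t, ht⟩ | ⟨d', rfl, ht⟩
    · exact ih (X := fun v => X (Fin.cons t v))
        (fun v w hv hw => (Fin.cons_right_injective t) (hX _ _ hv hw)) ht
    · refine absurd (Set.Subsingleton.finite fun s hs t ht => ?_) ht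
      obtain ⟨v, hv⟩ := FibDimGE.nonempty (X := fun v => X (Fin.cons s v)) hs
      obtain ⟨w, hw⟩ := FibDimGE.nonempty (X := fun v => X (Fin.cons t v)) ht
      simpa using congrFun (hX _ _ hv hw) 0

/-- A nonempty set has a largest `d` such that its dimension is at least `d`. -/
theorem exists_max {v : Fin n → M} (h : X v) : ∃ d, FibDimGE X d ∧ ¬ FibDimGE X (d + 1) := by
  classical
  have h0 := zero_of_mem h
  refine ⟨Nat.findGreatest (FibDimGE X) n, Nat.findGreatest_spec n.zero_le h0, fun h => ?_⟩
  exact absurd (Nat.le_findGreatest h.le h) (by omega)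

end FibDimGE

theorem infinite_prod_iff {P : M → M → Prop} :
    {p : M × M | P p.1 p.2}.Infinite ↔
      (∃ s, {t | P s t}.Infinite) ∨ {s | ∃ t, P s t}.Infinite := by
  constructor
  · intro h
    by_contra! hc
    obtain ⟨h1, h2⟩ := hc
    refine h ((h2.biUnion fun s _ => ((Set.not_infinite.1 (not_not.2 (h1 s))).image (Prod.mk s))).subset ?_)
    rintro ⟨s, t⟩ hp
    exact Set.mem_biUnion (show s ∈ {s | ∃ t, P s t} from ⟨t, hp⟩) ⟨t, hp, rfl⟩
  · rintro (⟨s, h⟩ | h)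
    · exact (h.image (Prod.mk_right_injective s).injOn).mono (by rintro _ ⟨t, ht, rfl⟩; exact ht)
    · refine Set.Infinite.of_image Prod.fst (h.mono ?_)
      rintro s ⟨t, ht⟩
      exact ⟨(s, t), ht, rfl⟩

theorem liftDim_liftDim_iff {F : M → M → ℕ → Prop} {d : ℕ} :
    liftDim (fun s => liftDim (F s)) d ↔ (∃ s t, F s t d) ∨
      (∃ d', d = d' + 1 ∧ {p : M × M | F p.1 p.2 d'}.Infinite) ∨
      ∃ d', d = d' + 2 ∧ {s | {t | F s t d'}.Infinite}.Infinite := by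
  simp only [fun d' => infinite_prod_iff (P := fun s t => F s t d')]
  constructor
  · rintro (⟨s, ⟨t, h⟩ | ⟨d', rfl, h⟩⟩ | ⟨d', rfl, h⟩)
    · exact Or.inl ⟨s, t, h⟩
    · exact Or.inr (Or.inl ⟨d', rfl, Or.inl ⟨s, h⟩⟩)
    · have h : ({s | ∃ t, F s t d'} ∪
          {s | ∃ d'', d' = d'' + 1 ∧ {t | F s t d''}.Infinite}).Infinite := h
      rcases Set.infinite_union.1 h with h | h
      · exact Or.inr (Or.inl ⟨d', rfl, Or.inr h⟩)
      · obtain ⟨s, d'', rfl, -⟩ := h.nonempty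
        refine Or.inr (Or.inr ⟨d'', rfl, h.mono ?_⟩)
        rintro s ⟨e, he, h⟩
        obtain rfl : d'' = e := by omega
        exact h
  · rintro (⟨s, t, h⟩ | ⟨d', rfl, ⟨s, h⟩ | h⟩ | ⟨d', rfl, h⟩)
    · exact Or.inl ⟨s, Or.inl ⟨t, h⟩⟩
    · exact Or.inl ⟨s, Or.inr ⟨d', rfl, h⟩⟩
    · exact Or.inr ⟨d', rfl, h.mono fun s h => Or.inl h⟩
    · exact Or.inr ⟨d' + 1, rfl, h.mono fun s h => Or.inr ⟨d', rfl, h⟩⟩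

variable {L : FirstOrder.Language} [L.Structure M] [LinearOrder M] [IsOMin L M]
variable {Γ : Type} [Tup M Γ]

theorem Df.liftDim {F : Γ → M → ℕ → Prop} (hF : ∀ d, Df L M (fun p : Γ × M => F p.1 p.2 d))
    (d : ℕ) : Df L M (fun g => liftDim (F g) d) := by
  refine Df.or (Df.ex (hF d)) ?_
  cases d with
  | zero => exact (df_const False).congr fun g => by simp
  | succ d => exact (Df.inf (P := fun g t => F g t d) (hF d)).congr fun g => by simp

theorem Df.iterDim {n : ℕ} {F : Γ → (Fin n → M) → ℕ → Prop}
    (hF : ∀ d, Df L M (fun p : Γ × (Fin n → M) => F p.1 p.2 d)) (d : ℕ) :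
    Df L M (fun g => iterDim (F g) d) := by
  induction n generalizing Γ d with
  | zero => exact Df.fix (P := fun g v => F g v d) (hF d) Fin.elim0
  | succ n ih =>
    refine Df.liftDim (F := fun g t => OMin.iterDim fun v => F g (Fin.cons t v)) (fun d => ?_) d
    refine ih (F := fun (p : Γ × M) v => F p.1 (Fin.cons p.2 v)) (fun d => ?_) d
    exact (hF d).comp (f := fun p : (Γ × M) × (Fin n → M) => (p.1.1, Fin.cons p.1.2 p.2))
      (by fun_prop)

theorem Df.fibDimGE {n : ℕ} {X : Γ → (Fin n → M) → Prop}
    (hX : Df L M (fun p : Γ × (Fin n → M) => X p.1 p.2)) (d : ℕ) :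
    Df L M (fun g => FibDimGE (X g) d) :=
  Df.iterDim (fun d => (df_const (d = 0)).and hX) d

theorem liftDim_comm {F : M → M → ℕ → Prop} (hF : ∀ d, Df L M (fun p : M × M => F p.1 p.2 d)) :
    liftDim (fun s => liftDim (F s)) = liftDim fun t => liftDim fun s => F s t := by
  funext d
  have hF' : ∀ d, Df L M (fun p : M × M => F p.2 p.1 d) := fun d =>
    (hF d).comp (f := fun p : M × M => (p.2, p.1)) (by fun_prop)
  rw [liftDim_liftDim_iff, liftDim_liftDim_iff, exists_comm]
  refine propext (or_congr_right (or_congr ?_ ?_))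
  · refine exists_congr fun d' => and_congr_right fun _ => ?_
    rw [← Set.infinite_image_iff (Prod.swap_injective.injOn), Set.image_swap_eq_preimage_swap]
    rfl
  · exact exists_congr fun d' => and_congr_right fun _ =>
      ⟨infinite_exchange (hF d'), infinite_exchange (hF' d')⟩

theorem liftDim_iterDim_comm {n : ℕ} {F : M → (Fin n → M) → ℕ → Prop}
    (hF : ∀ d, Df L M (fun p : M × (Fin n → M) => F p.1 p.2 d)) :
    liftDim (fun s => iterDim (F s)) = iterDim fun v => liftDim fun s => F s v := by
  induction n with
  | zero => rfl
  | succ n ih =>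
    refine (liftDim_comm (L := L) (F := fun s t => iterDim fun v => F s (Fin.cons t v))
      fun d => ?_).trans ?_
    · refine Df.iterDim (F := fun (p : M × M) v => F p.1 (Fin.cons p.2 v)) (fun d => ?_) d
      exact (hF d).comp (f := fun p : (M × M) × (Fin n → M) => (p.1.1, Fin.cons p.1.2 p.2))
        (by fun_prop)
    · refine congrArg liftDim (funext fun t => ih fun d => ?_)
      exact Df.fixLeft (P := fun t (p : M × (Fin n → M)) => F p.1 (Fin.cons t p.2) d)
        ((hF d).comp (f := fun p : M × (M × (Fin n → M)) => (p.2.1, Fin.cons p.1 p.2.2))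
          (by fun_prop)) t

theorem iterDim_comm {m n : ℕ} {F : (Fin m → M) → (Fin n → M) → ℕ → Prop}
    (hF : ∀ d, Df L M (fun p : (Fin m → M) × (Fin n → M) => F p.1 p.2 d)) :
    iterDim (fun x => iterDim (F x)) = iterDim fun y => iterDim fun x => F x y := by
  induction m with
  | zero => rfl
  | succ m ih =>
    have h1 : ∀ t, iterDim (fun x => iterDim (F (Fin.cons t x))) =
        iterDim fun y => iterDim fun x => F (Fin.cons t x) y := fun t => ih fun d =>
      Df.fixLeft (P := fun t (p : (Fin m → M) × (Fin n → M)) => F (Fin.cons t p.1) p.2 d)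
        ((hF d).comp (f := fun p : M × ((Fin m → M) × (Fin n → M)) => (Fin.cons p.1 p.2.1, p.2.2))
          (by fun_prop)) t
    refine (congrArg liftDim (funext h1)).trans (liftDim_iterDim_comm (L := L)
      (F := fun t y => iterDim fun x => F (Fin.cons t x) y) fun d => ?_)
    refine Df.iterDim (F := fun (p : M × (Fin n → M)) x => F (Fin.cons p.1 x) p.2) (fun d => ?_) d
    exact (hF d).comp (f := fun p : (M × (Fin n → M)) × (Fin m → M) => (Fin.cons p.1.1 p.2, p.1.2))
      (by fun_prop)

/-- A definable correspondence that is injective on `X` does not decrease dimension. -/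
theorem FibDimGE.of_injective {m n : ℕ} {X : (Fin m → M) → Prop} {Y : (Fin n → M) → Prop}
    {Ψ : (Fin m → M) → (Fin n → M) → Prop}
    (hΨ : Df L M (fun p : (Fin m → M) × (Fin n → M) => Ψ p.1 p.2))
    (hX : ∀ x, X x → ∃ y, Ψ x y) (hY : ∀ x y, Ψ x y → Y y)
    (hinj : ∀ x x' y, Ψ x y → Ψ x' y → x = x') {d : ℕ} (h : FibDimGE X d) : FibDimGE Y d := by
  have h1 : iterDim (fun x => iterDim fun y d => d = 0 ∧ Ψ x y) d := by
    refine iterDim_mono (fun x d hx => ?_) h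
    obtain ⟨rfl, hx⟩ := hx
    obtain ⟨y, hy⟩ := hX x hx
    exact FibDimGE.zero_of_mem (X := Ψ x) hy
  rw [iterDim_comm (L := L) fun d => (df_const (d = 0)).and hΨ] at h1
  refine iterDim_mono (fun y d hy => ?_) h1
  obtain ⟨x, hx⟩ := FibDimGE.nonempty (X := fun x => Ψ x y) hy
  exact ⟨FibDimGE.eq_zero_of_subsingleton (X := fun x => Ψ x y) (fun v w hv hw => hinj v w y hv hw)
    hy, hY x y hx⟩

/-- If all the fibres of `Φ` over a set of dimension at least `e` have dimension at least `p`, and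
`Φ` lies over a set `Y` of dimension at most `e` on the other side, then so does some fibre
over `Y`. -/
theorem FibDimGE.exists_fibre {m n : ℕ} {X : (Fin m → M) → Prop} {Y : (Fin n → M) → Prop}
    {Φ : (Fin m → M) → (Fin n → M) → Prop}
    (hΦ : Df L M (fun p : (Fin m → M) × (Fin n → M) => Φ p.1 p.2)) {e p : ℕ}
    (hX : FibDimGE X e) (hp : ∀ x, X x → FibDimGE (Φ x) p) (hY : ∀ x y, Φ x y → Y y)
    (hYe : ¬ FibDimGE Y (e + 1)) : ∃ y, Y y ∧ FibDimGE (fun x => Φ x y) p := by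
  have h1 : iterDim (fun x => iterDim fun y d => d = 0 ∧ Φ x y) (e + p) := by
    refine iterDim_add (fun x d hx => ?_) hX
    obtain ⟨rfl, hx⟩ := hx
    rw [Nat.zero_add]
    exact hp x hx
  rw [iterDim_comm (L := L) fun d => (df_const (d = 0)).and hΦ] at h1
  have hYm : ∀ y d, FibDimGE (fun x => Φ x y) d → Y y := fun y d h => by
    obtain ⟨x, hx⟩ := h.nonempty
    exact hY x y hx
  by_contra! hc
  cases p with
  | zero =>
    obtain ⟨y, d, h⟩ := exists_of_iterDim h1
    exact hc y (hYm y d h) (FibDimGE.of_le (X := fun x => Φ x y) h d.zero_le)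
  | succ p =>
    refine hYe ?_
    have := iterDim_sub (q := p) (G := fun y d => d = 0 ∧ Y y) (fun y d h => ?_) h1
    · rwa [show e + (p + 1) - p = e + 1 by omega] at this
    · have hy := hYm y d h
      refine ⟨?_, hy⟩
      by_contra hd
      exact hc y hy (FibDimGE.of_le (X := fun x => Φ x y) h (by omega))

theorem finite_image_of_factor {Γ A B : Type} {f : Γ → A} {g : Γ → B} {S : Set Γ}
    (hf : (f '' S).Finite) (h : ∀ y ∈ S, ∀ y' ∈ S, f y = f y' → g y = g y') :
    (g '' S).Finite := by
  obtain ⟨Z, hZ, hbij⟩ := Set.exists_subset_bijOn S f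
  have hZf : Z.Finite := by
    rw [← hbij.image_eq] at hf
    exact hf.of_finite_image hbij.injOn
  refine (hZf.image g).subset ?_
  rintro _ ⟨y, hy, rfl⟩
  obtain ⟨z, hz, hzy⟩ := hbij.surjOn ⟨y, hy, rfl⟩
  exact ⟨z, hz, h z (hZ hz) y hy hzy⟩

/-- A definable family of pairwise equal or disjoint sets, each of dimension at least that of
their union, is finite. -/
theorem finite_classes {n : ℕ} {C : Γ → (Fin n → M) → Prop} {Y : Γ → Prop}
    (hC : Df L M (fun p : Γ × (Fin n → M) => C p.1 p.2)) (hY : Df L M Y)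
    (hdisj : ∀ y y' v, Y y → Y y' → C y v → C y' v → C y = C y') {e : ℕ}
    (he : ∀ y, Y y → FibDimGE (C y) e) (hU : ¬ FibDimGE (fun v => ∃ y, Y y ∧ C y v) (e + 1)) :
    (C '' {y | Y y}).Finite := by
  induction n generalizing Y e with
  | zero =>
    refine (Set.finite_singleton fun _ => True).subset ?_
    rintro _ ⟨y, hy, rfl⟩
    obtain ⟨v, hv⟩ := (he y hy).nonempty
    funext w
    rw [Subsingleton.elim w v]
    exact eq_true hv
  | succ n ih =>
    have hCt : Df L M (fun p : (Γ × M) × (Fin n → M) => C p.1.1 (Fin.cons p.1.2 p.2)) :=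
      hC.comp (f := fun p : (Γ × M) × (Fin n → M) =>
        (p.1.1, (Fin.cons p.1.2 p.2 : Fin (n + 1) → M))) (by fun_prop)
    have hCe : ∀ d, Df L M (fun p : Γ × M => FibDimGE (fun v => C p.1 (Fin.cons p.2 v)) d) :=
      fun d => Df.fibDimGE (X := fun (p : Γ × M) v => C p.1 (Fin.cons p.2 v)) hCt d
    have slice : ∀ (Z : Γ → Prop) (t : M) (d : ℕ), Df L M Z → (∀ y, Z y → Y y) →
        (∀ y, Z y → FibDimGE (fun v => C y (Fin.cons t v)) d) →
        ¬ FibDimGE (fun v => ∃ y, Y y ∧ C y (Fin.cons t v)) (d + 1) →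
        (C '' {y | Z y}).Finite := by
      intro Z t d hZ hZY hd hUt
      have := ih (C := fun y v => C y (Fin.cons t v)) (Y := Z) (e := d)
        (Df.fixLeft (P := fun t (p : Γ × (Fin n → M)) => C p.1 (Fin.cons t p.2))
          (hCt.comp (f := fun p : M × (Γ × (Fin n → M)) => ((p.2.1, p.1), p.2.2)) (by fun_prop)) t)
        hZ (fun y y' v hy hy' hv hv' => by
          rw [hdisj y y' _ (hZY y hy) (hZY y' hy') hv hv']) hd
        (fun h => hUt (h.mono fun v ⟨y, hy, hv⟩ => ⟨y, hZY y hy, hv⟩))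
      refine finite_image_of_factor this fun y hy y' hy' hyy => ?_
      obtain ⟨v, hv⟩ := (hd y hy).nonempty
      exact hdisj y y' _ (hZY y hy) (hZY y' hy') hv (by rwa [← congrFun hyy v])
    have hU1 : ∀ t, ¬ FibDimGE (fun v => ∃ y, Y y ∧ C y (Fin.cons t v)) (e + 1) :=
      fun t ht => hU (Or.inl ⟨t, ht⟩)
    have hB : {t | FibDimGE (fun v => ∃ y, Y y ∧ C y (Fin.cons t v)) e}.Finite :=
      Set.not_infinite.1 fun h => hU (Or.inr ⟨e, rfl, h⟩)
    have h1 : (C '' {y | Y y ∧ ∃ t, FibDimGE (fun v => C y (Fin.cons t v)) e}).Finite := by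
      refine (hB.biUnion fun t _ => slice (fun y => Y y ∧ FibDimGE (fun v => C y (Fin.cons t v)) e)
        t e (hY.and (Df.fix (P := fun y t => FibDimGE (fun v => C y (Fin.cons t v)) e)
          (hCe e) t)) (fun y h => h.1) (fun y h => h.2) (hU1 t)).subset ?_
      rintro _ ⟨y, ⟨hy, t, ht⟩, rfl⟩
      exact Set.mem_biUnion (show t ∈ {t | _} from ht.mono fun v hv => ⟨y, hy, hv⟩)
        ⟨y, ⟨hy, ht⟩, rfl⟩
    have h2 : (C '' {y | Y y ∧ ¬ ∃ t, FibDimGE (fun v => C y (Fin.cons t v)) e}).Finite := by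
      cases e with
      | zero =>
        refine Set.finite_empty.subset ?_
        rintro _ ⟨y, ⟨hy, hn⟩, rfl⟩
        rcases he y hy with h | ⟨d, hd, -⟩
        · exact hn h
        · omega
      | succ e =>
        refine finite_image_of_finite_fibres (T := fun y t =>
          ¬ FibDimGE (fun v => ∃ y, Y y ∧ C y (Fin.cons t v)) (e + 1) ∧
          FibDimGE (fun v => C y (Fin.cons t v)) e) (hY.and (Df.ex (hCe _)).not) ?_ C ?_ ?_ ?_
        · refine Df.and (Df.not ?_) (hCe e)
          refine Df.comp (P := fun t => FibDimGE (fun v => ∃ y, Y y ∧ C y (Fin.cons t v)) (e + 1))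
            (f := fun p : Γ × M => p.2) (Df.fibDimGE
              (X := fun (t : M) v => ∃ y, Y y ∧ C y (Fin.cons t v)) (Df.ex (Df.and
              (hY.comp (f := fun p : (M × (Fin n → M)) × Γ => p.2) ?_) (hCt.comp
              (f := fun p : (M × (Fin n → M)) × Γ => ((p.2, p.1.1), p.1.2)) ?_))) _) ?_
          all_goals fun_prop
        · intro y y' _ _ h
          rw [h]
        · rintro y ⟨hy, hn⟩
          rcases he y hy with h | ⟨d, hd, h⟩
          · exact absurd h hn
          · obtain rfl : e = d := by omega
            exact (h.sdiff hB).mono fun t ht => ⟨ht.2, ht.1⟩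
        · intro t
          by_cases ht : FibDimGE (fun v => ∃ y, Y y ∧ C y (Fin.cons t v)) (e + 1)
          · refine Set.finite_empty.subset ?_
            rintro _ ⟨y, ⟨-, h, -⟩, rfl⟩
            exact h ht
          · refine (slice (fun y => Y y ∧ FibDimGE (fun v => C y (Fin.cons t v)) e) t e
              (hY.and (Df.fix (P := fun y t => FibDimGE (fun v => C y (Fin.cons t v)) e)
          (hCe e) t)) (fun y h => h.1) (fun y h => h.2) ht).subset
              (Set.image_mono ?_)
            rintro y ⟨⟨hy, -⟩, -, h⟩
            exact ⟨hy, h⟩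
    refine (h1.union h2).subset ?_
    rintro _ ⟨y, hy, rfl⟩
    by_cases h : ∃ t, FibDimGE (fun v => C y (Fin.cons t v)) e
    · exact Or.inl ⟨y, ⟨hy, h⟩, rfl⟩
    · exact Or.inr ⟨y, ⟨hy, h⟩, rfl⟩

end Dimension

end OMin
namespace OMin

/-- An injective endomorphism of an abelian group that maps a subgroup of finite index onto itself
is surjective. -/
theorem surjective_of_map_eq {A : Type} [AddCommGroup A] (H : AddSubgroup A) [Finite (A ⧸ H)]
    {f : A →+ A} (hf : Function.Injective f) (hH : H.map f = H) : Function.Surjective f := by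
  have hle : H ≤ H.comap f := AddSubgroup.map_le_iff_le_comap.1 hH.le
  have hinj : Function.Injective (QuotientAddGroup.map H H f hle) := by
    rw [injective_iff_map_eq_zero]
    intro s hs
    induction s using QuotientAddGroup.induction_on with
    | H s =>
      rw [QuotientAddGroup.map_mk, QuotientAddGroup.eq_zero_iff, ← hH] at hs
      obtain ⟨t, ht, hts⟩ := hs
      rw [QuotientAddGroup.eq_zero_iff, ← hf hts]
      exact ht
  intro y
  obtain ⟨s, hs⟩ := Finite.surjective_of_injective hinj (y : A ⧸ H)
  induction s using QuotientAddGroup.induction_on with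
  | H s =>
    rw [QuotientAddGroup.map_mk, QuotientAddGroup.eq, ← hH] at hs
    obtain ⟨t, -, ht⟩ := hs
    exact ⟨s + t, by rw [map_add, ht, add_neg_cancel_left]⟩

section NonUnitalRing

variable {A : Type} [NonUnitalRing A]

/-- The right ideal `x · A`. -/
def principal (x : A) : AddSubgroup A := (AddMonoidHom.mulLeft x).range

/-- `x · c = 0` only for `c = 0`. -/
def LeftCancels (x : A) : Prop := ∀ c, x * c = 0 → c = 0

theorem LeftCancels.injective {x : A} (hx : LeftCancels x) :
    Function.Injective (AddMonoidHom.mulLeft x) :=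
  (injective_iff_map_eq_zero _).2 hx

theorem LeftCancels.mul {x y : A} (hx : LeftCancels x) (hy : LeftCancels y) :
    LeftCancels (x * y) :=
  fun c hc => hy c (hx _ (by rw [← mul_assoc, hc]))

theorem principal_mul (x y : A) :
    principal (x * y) = (principal y).map (AddMonoidHom.mulLeft x) := by
  rw [principal, principal, AddMonoidHom.map_range]
  congr 1
  ext c
  exact mul_assoc x y c

theorem principal_mul_le (x y : A) : principal (x * y) ≤ principal x := by
  rintro _ ⟨c, rfl⟩
  exact ⟨y * c, (mul_assoc x y c).symm⟩

/-- Left multiplication by `a`. -/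
def leftMul (a : A) : AddMonoid.End A := AddMonoidHom.mulLeft a

theorem principal_iterate (a x : A) (n : ℕ) :
    principal ((a * ·)^[n] x) = (principal x).map (leftMul a ^ n : AddMonoid.End A) := by
  induction n with
  | zero => exact (AddSubgroup.map_id _).symm
  | succ n ih =>
    rw [Function.iterate_succ_apply', principal_mul, ih, pow_succ']
    exact AddSubgroup.map_map _ _ _

theorem mul_surjective_of_principal_eq {a x : A} (ha : LeftCancels a)
    [Finite (A ⧸ principal x)] {n m : ℕ} (hnm : n < m)
    (h : principal ((a * ·)^[n] x) = principal ((a * ·)^[m] x)) :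
    Function.Surjective (a * ·) := by
  have hinj : ∀ k, Function.Injective (leftMul a ^ k : AddMonoid.End A) := fun k => by
    rw [AddMonoid.End.coe_pow]
    exact ha.injective.iterate k
  obtain ⟨k, rfl⟩ := Nat.exists_eq_add_of_lt hnm
  rw [principal_iterate, principal_iterate, add_assoc, pow_add] at h
  have h' : (principal x).map (leftMul a ^ n : AddMonoid.End A) =
      ((principal x).map (leftMul a ^ (k + 1) : AddMonoid.End A)).map
        (leftMul a ^ n : AddMonoid.End A) := h.trans (AddSubgroup.map_map _ _ _).symm
  have hs := surjective_of_map_eq _ (hinj (k + 1)) (AddSubgroup.map_injective (hinj n) h').symm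
  intro y
  obtain ⟨c, hc⟩ := hs y
  rw [pow_succ'] at hc
  exact ⟨_, hc⟩

end NonUnitalRing

section DefRing

variable {L : FirstOrder.Language} {M : Type} [L.Structure M]

namespace DefRing

/-- The carrier of a definable ring as a ring. -/
instance (R : DefRing L M) : NonUnitalRing ↥R.carrier :=
  letI := R.addSub; letI := R.zeroSub; letI := R.negSub
  { add_assoc := fun a b c => Subtype.ext (R.hadd_assoc _ a.2 _ b.2 _ c.2)
    zero_add := fun a => Subtype.ext (R.hzero_add _ a.2)
    add_zero := fun a => Subtype.ext (add_zero' a.2)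
    add_comm := fun a b => Subtype.ext (R.hadd_comm _ a.2 _ b.2)
    neg_add_cancel := fun a => Subtype.ext (R.hneg_add _ a.2)
    nsmul := nsmulRec
    zsmul := zsmulRec
    mul := fun a b => ⟨R.mul a b, R.mul_mem _ a.2 _ b.2⟩
    mul_assoc := fun a b c => Subtype.ext (R.hmul_assoc _ a.2 _ b.2 _ c.2)
    left_distrib := fun a b c => Subtype.ext (R.hleft_distrib _ a.2 _ b.2 _ c.2)
    right_distrib := fun a b c => Subtype.ext (R.hright_distrib _ a.2 _ b.2 _ c.2)
    zero_mul := fun a => Subtype.ext (zero_mul' a.2)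
    mul_zero := fun a => Subtype.ext (mul_zero' a.2) }

variable {R : DefRing L M}

variable {Γ : Type} [Tup M Γ]

theorem df_carrier {f : Γ → Fin R.k → M} (hf : Coord M f) : Df L M (fun g => f g ∈ R.carrier) :=
  Df.comp (P := fun v => v ∈ R.carrier) R.carrier_def hf

theorem df_mul {f₁ f₂ f₃ : Γ → Fin R.k → M} (h₁ : Coord M f₁) (h₂ : Coord M f₂)
    (h₃ : Coord M f₃) :
    Df L M (fun g => f₁ g ∈ R.carrier ∧ f₂ g ∈ R.carrier ∧ R.mul (f₁ g) (f₂ g) = f₃ g) :=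
  Df.comp (P := fun p : (Fin R.k → M) × (Fin R.k → M) × (Fin R.k → M) => p.1 ∈ R.carrier ∧
    p.2.1 ∈ R.carrier ∧ R.mul p.1 p.2.1 = p.2.2) R.mul_def (h₁.prodMk (h₂.prodMk h₃))

theorem df_add {f₁ f₂ f₃ : Γ → Fin R.k → M} (h₁ : Coord M f₁) (h₂ : Coord M f₂)
    (h₃ : Coord M f₃) :
    Df L M (fun g => f₁ g ∈ R.carrier ∧ f₂ g ∈ R.carrier ∧ R.add (f₁ g) (f₂ g) = f₃ g) :=
  Df.comp (P := fun p : (Fin R.k → M) × (Fin R.k → M) × (Fin R.k → M) => p.1 ∈ R.carrier ∧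
    p.2.1 ∈ R.carrier ∧ R.add p.1 p.2.1 = p.2.2) R.add_def (h₁.prodMk (h₂.prodMk h₃))

end DefRing

end DefRing

end OMin
namespace OMin

namespace DefRing

variable {L : FirstOrder.Language} {M : Type} [L.Structure M]

section Definability

variable (R : DefRing L M)

/-- `w` is a right multiple of `u`. -/
def Divides (u w : Fin R.k → M) : Prop := ∃ r, u ∈ R.carrier ∧ r ∈ R.carrier ∧ R.mul u r = w

/-- `u` is an element of the ring with `u · c = 0` only for `c = 0`. -/
def Cancels (u : Fin R.k → M) : Prop :=
  u ∈ R.carrier ∧ ∀ c, u ∈ R.carrier ∧ c ∈ R.carrier ∧ R.mul u c = R.zero → c = R.zero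

/-- Both `u` and `w` are left cancellable and the right ideal of `u` contains that of `w`. -/
def Above (u w : Fin R.k → M) : Prop :=
  R.Cancels u ∧ R.Cancels w ∧ ∀ z, R.Divides w z → R.Divides u z

/-- `v` lies in the coset of `u` modulo the right multiples of `x`. -/
def Coset (x u v : Fin R.k → M) : Prop :=
  ∃ z, R.Divides x z ∧ u ∈ R.carrier ∧ z ∈ R.carrier ∧ R.add u z = v

variable {R}

theorem divides_coe {x y : R.carrier} : R.Divides x y ↔ y ∈ principal x :=
  ⟨fun ⟨r, _, hr, h⟩ => ⟨⟨r, hr⟩, Subtype.ext h⟩, fun ⟨r, h⟩ => ⟨r, x.2, r.2, congrArg Subtype.val h⟩⟩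

theorem Divides.mem {u w : Fin R.k → M} (h : R.Divides u w) : w ∈ R.carrier := by
  obtain ⟨r, hu, hr, rfl⟩ := h
  exact R.mul_mem _ hu _ hr

theorem cancels_coe {x : R.carrier} : R.Cancels x ↔ LeftCancels x :=
  ⟨fun h c hc => Subtype.ext (h.2 c ⟨x.2, c.2, congrArg Subtype.val hc⟩),
    fun h => ⟨x.2, fun c hc => congrArg Subtype.val (h ⟨c, hc.2.1⟩ (Subtype.ext hc.2.2))⟩⟩

theorem above_coe {x y : R.carrier} :
    R.Above x y ↔ LeftCancels x ∧ LeftCancels y ∧ principal y ≤ principal x := by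
  rw [Above, cancels_coe, cancels_coe]
  refine and_congr_right fun _ => and_congr_right fun _ => ⟨fun h z hz => ?_, fun h z hz => ?_⟩
  · exact divides_coe.1 (h z (divides_coe.2 hz))
  · lift z to R.carrier using hz.mem
    exact divides_coe.2 (h (divides_coe.1 hz))

theorem coset_coe {x u v : R.carrier} :
    R.Coset x u v ↔ (u : R.carrier ⧸ principal x) = v := by
  rw [QuotientAddGroup.eq]
  constructor
  · rintro ⟨z, hz, -, hz', h⟩
    lift z to R.carrier using hz'
    have h : u + z = v := Subtype.ext h
    rw [← h, neg_add_cancel_left]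
    exact divides_coe.1 hz
  · exact fun h => ⟨_, divides_coe.2 h, u.2, Subtype.property _,
      congrArg Subtype.val (add_neg_cancel_left u v)⟩

theorem Coset.mem {x u v : Fin R.k → M} (h : R.Coset x u v) : v ∈ R.carrier := by
  obtain ⟨z, -, hu, hz, rfl⟩ := h
  exact R.add_mem _ hu _ hz

variable {Γ : Type} [Tup M Γ]

theorem df_divides {f₁ f₂ : Γ → Fin R.k → M} (h₁ : Coord M f₁) (h₂ : Coord M f₂) :
    Df L M (fun g => R.Divides (f₁ g) (f₂ g)) :=
  Df.ex (df_mul (by fun_prop) (by fun_prop) (by fun_prop))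

theorem df_cancels {f : Γ → Fin R.k → M} (hf : Coord M f) :
    Df L M (fun g => R.Cancels (f g)) := by
  refine Df.and (df_carrier hf) (Df.all (Df.imp ?_ ?_))
  · exact Df.fix (P := fun (p : Γ × (Fin R.k → M)) z => f p.1 ∈ R.carrier ∧ p.2 ∈ R.carrier ∧
      R.mul (f p.1) p.2 = z) (df_mul (by fun_prop) (by fun_prop) (by fun_prop)) R.zero
  · exact (df_eq_const R.zero).comp (f := fun p : Γ × (Fin R.k → M) => p.2) (by fun_prop)

theorem df_above {f₁ f₂ : Γ → Fin R.k → M} (h₁ : Coord M f₁) (h₂ : Coord M f₂) :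
    Df L M (fun g => R.Above (f₁ g) (f₂ g)) := by
  refine (df_cancels h₁).and ((df_cancels h₂).and (Df.all
    (Df.imp (df_divides ?_ ?_) (df_divides ?_ ?_))))
  all_goals fun_prop

theorem df_coset {f₁ f₂ f₃ : Γ → Fin R.k → M} (h₁ : Coord M f₁) (h₂ : Coord M f₂)
    (h₃ : Coord M f₃) : Df L M (fun g => R.Coset (f₁ g) (f₂ g) (f₃ g)) := by
  refine Df.ex (Df.and (df_divides ?_ ?_) (df_add ?_ ?_ ?_))
  all_goals fun_prop

/-- The graph of left multiplication by `x`. -/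
def mulGraph (x : R.carrier) (u v : Fin R.k → M) : Prop :=
  (x : Fin R.k → M) ∈ R.carrier ∧ u ∈ R.carrier ∧ R.mul x u = v

theorem df_mulGraph (x : R.carrier) {f₁ f₂ : Γ → Fin R.k → M} (h₁ : Coord M f₁)
    (h₂ : Coord M f₂) : Df L M (fun g => mulGraph x (f₁ g) (f₂ g)) :=
  Df.fixLeft (P := fun x g => x ∈ R.carrier ∧ f₁ g ∈ R.carrier ∧ R.mul x (f₁ g) = f₂ g)
    (df_mul (by fun_prop) (by fun_prop) (by fun_prop)) (x : Fin R.k → M)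

theorem mulGraph_injective {x : R.carrier} (hx : LeftCancels x) (u u' v : Fin R.k → M)
    (h : mulGraph x u v) (h' : mulGraph x u' v) : u = u' := by
  lift u to R.carrier using h.2.1
  lift u' to R.carrier using h'.2.1
  exact congrArg _ (hx.injective (Subtype.ext (h.2.2.trans h'.2.2.symm)))

end Definability

section OMinimal

variable [LinearOrder M] [IsOMin L M] {R : DefRing L M}

/-- The right ideal of a left cancellable element has finite index. -/
theorem finite_quotient_principal {x : R.carrier} (hx : LeftCancels x) :
    Finite (R.carrier ⧸ principal x) := by
  obtain ⟨d, hd, hd'⟩ := FibDimGE.exists_max (X := fun v => v ∈ R.carrier) (0 : R.carrier).2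
  have hfin := finite_classes (C := R.Coset x) (Y := fun v => v ∈ R.carrier) (e := d)
    (Df.fixLeft (P := fun x (p : (Fin R.k → M) × (Fin R.k → M)) => R.Coset x p.1 p.2)
      (df_coset (by fun_prop) (by fun_prop) (by fun_prop)) (x : Fin R.k → M))
    (df_carrier Coord.id) ?_ ?_ ?_
  · have h : Set.Finite ((fun u : R.carrier => R.Coset x u) '' Set.univ) := by
      refine hfin.subset ?_
      rintro _ ⟨u, -, rfl⟩
      exact ⟨u, u.2, rfl⟩
    have h' := finite_image_of_factor (g := QuotientAddGroup.mk (s := principal x)) h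
      fun u _ v _ huv => coset_coe.1 ((congrFun huv v).mpr (coset_coe.2 rfl))
    rw [Set.image_univ, Set.range_eq_univ.2 (QuotientAddGroup.mk_surjective)] at h'
    exact Set.finite_univ_iff.1 h'
  · intro u u' v hu hu' h h'
    lift v to R.carrier using h.mem
    lift u to R.carrier using hu
    lift u' to R.carrier using hu'
    have huu := (coset_coe.1 h).trans (coset_coe.1 h').symm
    have hiff : ∀ w, R.Coset x u w → R.Coset x u' w := fun w hw => by
      lift w to R.carrier using hw.mem
      exact coset_coe.2 (huu.symm.trans (coset_coe.1 hw))
    have hiff' : ∀ w, R.Coset x u' w → R.Coset x u w := fun w hw => by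
      lift w to R.carrier using hw.mem
      exact coset_coe.2 (huu.trans (coset_coe.1 hw))
    exact funext fun w => propext ⟨hiff w, hiff' w⟩
  · intro u hu
    lift u to R.carrier using hu
    refine FibDimGE.of_injective (L := L) (X := fun v => v ∈ R.carrier)
      (Ψ := fun r v => ∃ z, mulGraph x r z ∧
        (u : Fin R.k → M) ∈ R.carrier ∧ z ∈ R.carrier ∧ R.add u z = v) ?_ ?_ ?_ ?_ hd
    · refine Df.ex (Df.and (df_mulGraph x (by fun_prop) (by fun_prop)) ?_)
      exact Df.fixLeft (P := fun u (p : ((Fin R.k → M) × (Fin R.k → M)) × (Fin R.k → M)) =>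
        u ∈ R.carrier ∧ p.2 ∈ R.carrier ∧ R.add u p.2 = p.1.2)
        (df_add (by fun_prop) (by fun_prop) (by fun_prop)) (u : Fin R.k → M)
    · exact fun r hr => ⟨_, _, ⟨x.2, hr, rfl⟩, u.2, R.mul_mem _ x.2 _ hr, rfl⟩
    · exact fun r v ⟨z, hz, h⟩ => ⟨z, ⟨r, hz⟩, h⟩
    · rintro r r' v ⟨z, hz, -, hzC, h⟩ ⟨z', hz', -, hzC', h'⟩
      lift z to R.carrier using hzC
      lift z' to R.carrier using hzC'
      have hzz : z = z' := add_left_cancel (a := u) (Subtype.ext (h.trans h'.symm))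
      subst hzz
      exact mulGraph_injective hx _ _ _ hz hz'
  · exact fun h => hd' (h.mono fun v ⟨u, _, hv⟩ => hv.mem)

/-- If there is a left cancellable element, then there is one, `x`, such that the set of left
cancellable elements that generate the same right ideal as `x` has maximal dimension. -/
theorem exists_fibDimGE_above {e : ℕ} (he : FibDimGE R.Cancels e)
    (he' : ¬ FibDimGE R.Cancels (e + 1)) :
    ∃ x : R.carrier, LeftCancels x ∧ FibDimGE (fun v => R.Above x v ∧ R.Above v x) e := by
  have hp : ∀ x, R.Cancels x → FibDimGE (R.Above x) e := by
    intro x hx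
    lift x to R.carrier using hx.1
    rw [cancels_coe] at hx
    refine FibDimGE.of_injective (L := L) (X := R.Cancels)
      (Ψ := fun u v => R.Cancels u ∧ mulGraph x u v)
      ((df_cancels (by fun_prop)).and (df_mulGraph x (by fun_prop) (by fun_prop)))
      (fun u hu => ⟨_, hu, x.2, hu.1, rfl⟩) ?_
      (fun u u' v h h' => mulGraph_injective hx u u' v h.2 h'.2) he
    rintro u _ ⟨hu, -, huC, rfl⟩
    lift u to R.carrier using huC
    rw [cancels_coe] at hu
    exact above_coe.2 ⟨hx, hx.mul hu, principal_mul_le x u⟩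
  obtain ⟨y, hy, hye⟩ := FibDimGE.exists_fibre (L := L) (Φ := R.Above) (p := e)
    (df_above (by fun_prop) (by fun_prop)) he hp (fun _ _ h => h.2.1) he'
  lift y to R.carrier using hy.1
  rw [cancels_coe] at hy
  have := finite_quotient_principal hy
  have hfin : Finite {S : AddSubgroup R.carrier | principal y ≤ S} :=
    Finite.of_equiv _ (QuotientAddGroup.comapMk'OrderIso (principal y)).toEquiv
  obtain ⟨S, -, hS⟩ := FibDimGE.exists_of_finite (S := {S | principal y ≤ S})
    (Z := fun S u => ∃ x : R.carrier, (x : Fin R.k → M) = u ∧ LeftCancels x ∧ principal x = S)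
    (Set.toFinite _) (hye.mono fun u hu => by
      lift u to R.carrier using hu.1.1
      have hu := above_coe.1 hu
      exact ⟨principal u, hu.2.2, u, rfl, hu.1, rfl⟩)
  obtain ⟨_, x, rfl, hx, rfl⟩ := hS.nonempty
  refine ⟨x, hx, hS.mono ?_⟩
  rintro _ ⟨v, rfl, hv, hvx⟩
  exact ⟨above_coe.2 ⟨hx, hv, hvx.le⟩, above_coe.2 ⟨hv, hx, hvx.ge⟩⟩

/-- Left multiplication by a left cancellable element is surjective. -/
theorem mul_surjective {a : R.carrier} (ha : LeftCancels a) :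
    Function.Surjective (a * ·) := by
  obtain ⟨e, he, he'⟩ := FibDimGE.exists_max (X := R.Cancels) (cancels_coe.2 ha)
  obtain ⟨x, hx, hxe⟩ := exists_fibDimGE_above he he'
  have := finite_quotient_principal hx
  let C : (Fin R.k → M) → (Fin R.k → M) → Prop := fun u v => R.Above u v ∧ R.Above v u
  have hC {u v : R.carrier} :
      C u v ↔ LeftCancels u ∧ LeftCancels v ∧ principal u = principal v := by
    refine (and_congr above_coe above_coe).trans ⟨fun h => ?_, fun h => ?_⟩
    · exact ⟨h.1.1, h.1.2.1, h.2.2.2.antisymm h.1.2.2⟩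
    · exact ⟨⟨h.1, h.2.1, h.2.2.ge⟩, h.2.1, h.1, h.2.2.le⟩
  have hCdf : Df L M (fun p : (Fin R.k → M) × (Fin R.k → M) => C p.1 p.2) :=
    (df_above (by fun_prop) (by fun_prop)).and (df_above (by fun_prop) (by fun_prop))
  have hfin := finite_classes (C := C) (Y := fun u => R.Cancels u ∧ FibDimGE (C u) e) (e := e)
    hCdf ((df_cancels Coord.id).and (Df.fibDimGE hCdf e)) ?_ (fun _ h => h.2)
    (fun h => he' (h.mono fun v ⟨_, _, hv⟩ => hv.2.1))
  · have hit : ∀ n : ℕ, LeftCancels ((a * ·)^[n] x) ∧ FibDimGE (C ((a * ·)^[n] x)) e := by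
      intro n
      induction n with
      | zero => exact ⟨hx, hxe⟩
      | succ n ih =>
        rw [Function.iterate_succ_apply']
        refine ⟨ha.mul ih.1, FibDimGE.of_injective (L := L)
          (Ψ := fun u v => C ((a * ·)^[n] x) u ∧ mulGraph a u v)
          (Df.and ((hCdf.fixLeft _).comp Coord.id.fst) (df_mulGraph a (by fun_prop) (by fun_prop)))
          (fun u hu => ⟨_, hu, a.2, hu.1.2.1.1, rfl⟩) ?_
          (fun u u' v h h' => mulGraph_injective ha u u' v h.2 h'.2) ih.2⟩
        rintro u _ ⟨hu, -, huC, rfl⟩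
        lift u to R.carrier using huC
        obtain ⟨h₁, h₂, h₃⟩ := hC.1 hu
        exact (hC (v := a * u)).2 ⟨ha.mul h₁, ha.mul h₂, by rw [principal_mul, h₃, principal_mul]⟩
    have hmem : ∀ n : ℕ, C ((a * ·)^[n] x) ∈ C '' {u | R.Cancels u ∧ FibDimGE (C u) e} :=
      fun n => ⟨_, ⟨cancels_coe.2 (hit n).1, (hit n).2⟩, rfl⟩
    obtain ⟨n, m, hnm, h⟩ := hfin.exists_lt_map_eq_of_forall_mem hmem
    refine mul_surjective_of_principal_eq (x := x) ha hnm ?_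
    exact (hC.1 ((congrFun h _).mpr (hC.2 ⟨(hit m).1, (hit m).1, rfl⟩))).2.2
  · intro u u' v hu hu' h h'
    lift u to R.carrier using hu.1.1
    lift u' to R.carrier using hu'.1.1
    lift v to R.carrier using h.2.1.1
    obtain ⟨h₁, h₂, h₃⟩ := hC.1 h
    obtain ⟨h₁', -, h₃'⟩ := hC.1 h'
    have huu := h₃.trans h₃'.symm
    ext w
    constructor
    · intro hw
      lift w to R.carrier using hw.2.1.1
      obtain ⟨-, hw₂, hw₃⟩ := hC.1 hw
      exact hC.2 ⟨h₁', hw₂, huu.symm.trans hw₃⟩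
    · intro hw
      lift w to R.carrier using hw.2.1.1
      obtain ⟨-, hw₂, hw₃⟩ := hC.1 hw
      exact hC.2 ⟨h₁, hw₂, huu.trans hw₃⟩

end OMinimal

end DefRing

/-- An element that is cancellable on both sides, and left multiplication by which is surjective,
is invertible. -/
theorem exists_identity_of_surjective {A : Type} [NonUnitalRing A] {a : A} (ha : LeftCancels a)
    (ha' : ∀ c, c * a = 0 → c = 0) (hs : Function.Surjective (a * ·)) :
    ∃ e : A, (∀ x, e * x = x ∧ x * e = x) ∧ ∃ b, a * b = e ∧ b * a = e := by
  obtain ⟨e, he⟩ := hs a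
  have hl : ∀ x, e * x = x := fun x => ha.injective (by
    change a * (e * x) = a * x
    rw [← mul_assoc]; exact congrArg (· * x) he)
  obtain ⟨b, hb⟩ := hs e
  refine ⟨e, fun x => ⟨hl x, ?_⟩, b, hb, ha.injective ?_⟩
  · rw [← sub_eq_zero]
    exact ha' _ (by rw [sub_mul, mul_assoc, hl, sub_self])
  · change a * (b * a) = a * e
    rw [← mul_assoc]
    exact (congrArg (· * a) hb).trans ((hl a).trans he.symm)

end OMin
namespace OMin

/-- In a definable ring every nonzero element is either a unit
(in particular `R` is unital) or a zero-divisor; so if `R` is not unital, every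
nonzero element is a zero-divisor. -/
theorem statement_12 {L : FirstOrder.Language} {M : Type} [L.Structure M] [LinearOrder M]
    (hM : OMinimal L M) (R : DefRing L M) :
    (∀ a ∈ R.carrier, a ≠ R.zero →
      (∃ e, R.IsIdentity e ∧ ∃ b ∈ R.carrier, R.mul a b = e ∧ R.mul b a = e) ∨
      (∃ c ∈ R.carrier, c ≠ R.zero ∧ (R.mul a c = R.zero ∨ R.mul c a = R.zero))) ∧
    (¬ R.IsUnital → ∀ a ∈ R.carrier, a ≠ R.zero →
      ∃ c ∈ R.carrier, c ≠ R.zero ∧ (R.mul a c = R.zero ∨ R.mul c a = R.zero)) := by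
  have := hM.isOMin
  have key : ∀ a ∈ R.carrier,
      (∃ e, R.IsIdentity e ∧ ∃ b ∈ R.carrier, R.mul a b = e ∧ R.mul b a = e) ∨
      (∃ c ∈ R.carrier, c ≠ R.zero ∧ (R.mul a c = R.zero ∨ R.mul c a = R.zero)) := by
    intro a ha
    refine or_iff_not_imp_right.2 fun h => ?_
    lift a to R.carrier using ha
    have hl : LeftCancels a := fun c hc => by
      by_contra hne
      exact h ⟨c, c.2, fun h0 => hne (Subtype.ext h0), Or.inl (congrArg Subtype.val hc)⟩
    have hr : ∀ c, c * a = 0 → c = 0 := fun c hc => by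
      by_contra hne
      exact h ⟨c, c.2, fun h0 => hne (Subtype.ext h0), Or.inr (congrArg Subtype.val hc)⟩
    obtain ⟨e, he, b, hab, hba⟩ := exists_identity_of_surjective hl hr
      (DefRing.mul_surjective hl)
    exact ⟨e, ⟨e.2, fun x hx => ⟨congrArg Subtype.val (he ⟨x, hx⟩).1,
      congrArg Subtype.val (he ⟨x, hx⟩).2⟩⟩, b, b.2, congrArg Subtype.val hab, congrArg Subtype.val hba⟩
  exact ⟨fun a ha _ => key a ha, fun hR a ha _ =>
    (key a ha).resolve_left fun ⟨e, he, _⟩ => hR ⟨e, he⟩⟩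

end OMin
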